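/- arXiv:1902.00962 — 2 statements merged into one kernel-verified Lean document; each statement's English description precedes it below -/
import Mathlib

section
/- Let (X,r) be a nondegenerate involutive braided set of finite order, let G = G(X,r), and let K be a field of characteristic 0. Then the group algebra K[G] has finite global dimension: there exists a natural number d such that every K[G]-module has projective dimension at most d. -/
/-- The left action `σ_x(y)`: first component of `r (x, y)`. -/
def sig {X : Type*} (r : X × X → X × X) (x y : X) : X := (r (x, y)).1

/-- The right action `τ_y(x)`: second component of `r (x, y)`. -/
def tau {X : Type*} (r : X × X → X × X) (y x : X) : X := (r (x, y)).2

/-- `r¹² = r × id`. -/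
def r12 {X : Type*} (r : X × X → X × X) : X × X × X → X × X × X :=
  fun t => ((r (t.1, t.2.1)).1, (r (t.1, t.2.1)).2, t.2.2)

/-- `r²³ = id × r`. -/
def r23 {X : Type*} (r : X × X → X × X) : X × X × X → X × X × X :=
  fun t => (t.1, (r (t.2.1, t.2.2)).1, (r (t.2.1, t.2.2)).2)

/-- The braid relation `r¹² ∘ r²³ ∘ r¹² = r²³ ∘ r¹² ∘ r²³`. -/
def IsBraided {X : Type*} (r : X × X → X × X) : Prop :=
  r12 r ∘ r23 r ∘ r12 r = r23 r ∘ r12 r ∘ r23 r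

/-- Nondegeneracy: every `σ_x` and every `τ_y` is bijective. -/
def Nondegenerate {X : Type*} (r : X × X → X × X) : Prop :=
  (∀ x, Function.Bijective (sig r x)) ∧ (∀ y, Function.Bijective (tau r y))

/-- The defining relators of the group `G(X,r)`:
`x · y · (σ_x(y) · τ_y(x))⁻¹` for all `x, y ∈ X`. -/
def ybRels {X : Type*} (r : X × X → X × X) : Set (FreeGroup X) :=
  { w | ∃ x y : X, w = FreeGroup.of x * FreeGroup.of y *
      (FreeGroup.of (sig r x y) * FreeGroup.of (tau r y x))⁻¹ }

/-- The group `G(X,r)` associated with `(X,r)`, presented by generators `X`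
and relations `x y = σ_x(y) τ_y(x)`. -/
abbrev YBGroup {X : Type*} (r : X × X → X × X) := PresentedGroup (ybRels r)

/-- The canonical map `ι : X → G(X,r)`. -/
def ybι {X : Type*} (r : X × X → X × X) : X → YBGroup r := PresentedGroup.of

open CategoryTheory in
/-- `pdLE R d M` : the `R`-module `M` has projective dimension at most `d`,
expressed via syzygies: for `d = 0`, `M` is projective; for `d+1`, there is a
surjection `f : P → M` from a projective module whose kernel has projective
dimension at most `d`. -/
def pdLE (R : Type*) [Ring R] : ℕ → ModuleCat R → Prop
  | 0, M => Module.Projective R M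
  | (d+1), M => ∃ (P : ModuleCat R) (f : P →ₗ[R] M), Module.Projective R P ∧
      Function.Surjective f ∧ pdLE R d (ModuleCat.of R (LinearMap.ker f))


namespace YBAux

open MonoidAlgebra

section alg

set_option linter.unusedSectionVars false

variable {K : Type*} [Field K] {G : Type*} [Group G]

/-- The subalgebra `K[H]` of `K[G]`. -/
noncomputable abbrev SA (K : Type*) [Field K] {G : Type*} [Group G] (H : Subgroup G) :
    Subalgebra K (MonoidAlgebra K G) :=
  Algebra.adjoin K ((MonoidAlgebra.of K G) '' (H : Set G))

theorem of_mem {H : Subgroup G} {h : G} (hh : h ∈ H) : MonoidAlgebra.of K G h ∈ SA K H :=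
  Algebra.subset_adjoin ⟨h, hh, rfl⟩

/-- additive maps out of the group algebra -/
noncomputable def addLift {N : Type*} [AddCommMonoid N] (φ : G → K →+ N) :
    MonoidAlgebra K G →+ N where
  toFun x := Finsupp.liftAddHom φ x.coeff
  map_zero' := by simp
  map_add' x y := by simp

theorem addLift_single {N : Type*} [AddCommMonoid N] (φ : G → K →+ N) (g : G) (a : K) :
    addLift φ (single g a) = φ g a := by
  simp [addLift]

theorem mkS_gen {H : Subgroup G} {M N : Type*} [AddCommMonoid M] [AddCommMonoid N]
    [Module (SA K H) M] [Module (SA K H) N] (f : M →+ N)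
    (hH : ∀ (h : G) (hh : h ∈ H) (m : M), f ((⟨of K G h, of_mem hh⟩ : SA K H) • m)
      = (⟨of K G h, of_mem hh⟩ : SA K H) • f m)
    (hK : ∀ (k : K) (m : M), f ((algebraMap K (SA K H) k) • m) = (algebraMap K (SA K H) k) • f m) :
    ∃ f' : M →ₗ[SA K H] N, ∀ m, f' m = f m := by
  refine ⟨{ f with map_smul' := ?_ }, fun m => rfl⟩
  rintro ⟨s, hs⟩ m
  simp only [RingHom.id_apply]
  change f (_ • m) = _ • f m
  revert m
  induction hs using Algebra.adjoin_induction with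
  | mem x hx =>
    obtain ⟨h, hh, rfl⟩ := hx
    exact hH h hh
  | algebraMap k => exact hK k
  | add x y hx hy h1 h2 =>
    intro m
    have e : (⟨x + y, add_mem hx hy⟩ : SA K H) = ⟨x, hx⟩ + ⟨y, hy⟩ := rfl
    rw [e, add_smul, map_add, h1, h2, add_smul]
  | mul x y hx hy h1 h2 =>
    intro m
    have e : (⟨x * y, mul_mem hx hy⟩ : SA K H) = ⟨x, hx⟩ * ⟨y, hy⟩ := rfl
    rw [e, mul_smul, h1, h2, mul_smul]

section Rmod
variable {M N : Type*} [AddCommGroup M] [AddCommGroup N]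
    [Module (MonoidAlgebra K G) M] [Module (MonoidAlgebra K G) N]

theorem mkS {H : Subgroup G} (f : M →+ N)
    (hH : ∀ (h : G) (_ : h ∈ H) (m : M), f (of K G h • m) = of K G h • f m)
    (hK : ∀ (k : K) (m : M), f ((algebraMap K (MonoidAlgebra K G) k) • m)
      = (algebraMap K (MonoidAlgebra K G) k) • f m) :
    ∃ f' : M →ₗ[SA K H] N, ∀ m, f' m = f m :=
  mkS_gen f hH hK

theorem S_of {H : Subgroup G} (f : M →ₗ[SA K H] N) {h : G} (hh : h ∈ H) (m : M) :
    f (of K G h • m) = of K G h • f m :=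
  f.map_smul (⟨of K G h, of_mem hh⟩ : SA K H) m

theorem S_alg {H : Subgroup G} (f : M →ₗ[SA K H] N) (k : K) (m : M) :
    f (algebraMap K (MonoidAlgebra K G) k • m) = algebraMap K (MonoidAlgebra K G) k • f m :=
  f.map_smul (algebraMap K (SA K H) k) m

/-- conjugation -/
noncomputable def cj (K : Type*) [Field K] {G : Type*} [Group G] {M N : Type*} [AddCommGroup M] [AddCommGroup N]
    [Module (MonoidAlgebra K G) M] [Module (MonoidAlgebra K G) N] (g : G) (f : M →+ N) : M →+ N where
  toFun m := of K G g • f (of K G g⁻¹ • m)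
  map_zero' := by simp
  map_add' x y := by simp

theorem ofmul {M : Type*} [AddCommMonoid M] [Module (MonoidAlgebra K G) M] (g h : G)  (m : M) : of K G g • of K G h • m = of K G (g * h) • m := by
  rw [smul_smul, map_mul]

theorem ofone {M : Type*} [AddCommMonoid M] [Module (MonoidAlgebra K G) M]  (m : M) : of K G 1 • m = m := by
  rw [map_one, one_smul]

theorem alg_of {M : Type*} [AddCommMonoid M] [Module (MonoidAlgebra K G) M] (k : K) (g : G)  (m : M) : of K G g • algebraMap K (MonoidAlgebra K G) k • m
    = algebraMap K (MonoidAlgebra K G) k • of K G g • m := by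
  rw [smul_smul, smul_smul, Algebra.commutes]

theorem exists_conj {H : Subgroup G} {t : G} (ht : ∀ h ∈ H, t * h = h * t) (f : M →ₗ[SA K H] N) :
    ∃ f' : M →ₗ[SA K H] N, ∀ m, f' m = of K G t • f (of K G t⁻¹ • m) := by
  refine mkS (cj K t f.toAddMonoidHom) ?_ ?_
  · intro h hh m
    change of K G t • f (of K G t⁻¹ • of K G h • m) = of K G h • of K G t • f (of K G t⁻¹ • m)
    have : t⁻¹ * h = h * t⁻¹ := by
      have := ht h hh
      calc t⁻¹ * h = t⁻¹ * (h * t) * t⁻¹ := by group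
        _ = h * t⁻¹ := by rw [← this]; group
    rw [ofmul, this, ← ofmul, S_of f hh, ofmul, ofmul, ht h hh]
  · intro k m
    change of K G t • f (of K G t⁻¹ • _ • m) = _ • of K G t • f (of K G t⁻¹ • m)
    rw [alg_of, S_alg, alg_of]

/-- conjugation as an operation on `S`-linear maps. -/
noncomputable def conj {H : Subgroup G} {t : G} (ht : ∀ h ∈ H, t * h = h * t) (f : M →ₗ[SA K H] N) :
    M →ₗ[SA K H] N := (exists_conj ht f).choose

theorem conj_apply {H : Subgroup G} {t : G} (ht : ∀ h ∈ H, t * h = h * t) (f : M →ₗ[SA K H] N)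
    (m : M) : conj ht f m = of K G t • f (of K G t⁻¹ • m) := (exists_conj ht f).choose_spec m

end Rmod

/-- coset representative -/
noncomputable def rep (H : Subgroup G) (g : G) : G :=
  Quotient.out (Quotient.mk (QuotientGroup.rightRel H) g)

theorem rep_mem (H : Subgroup G) (g : G) : g * (rep H g)⁻¹ ∈ H := by
  have h : (QuotientGroup.rightRel H) (rep H g) g :=
    Quotient.exact (Quotient.out_eq (Quotient.mk (QuotientGroup.rightRel H) g))
  rwa [QuotientGroup.rightRel_apply] at h

theorem rep_mul (H : Subgroup G) {h : G} (hh : h ∈ H) (g : G) : rep H (h * g) = rep H g := by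
  unfold rep
  congr 1
  apply Quotient.sound
  change (QuotientGroup.rightRel H) _ _
  rw [QuotientGroup.rightRel_apply]
  simpa using H.inv_mem hh

theorem proj_self (H : Subgroup G) : Module.Projective (SA K H) (MonoidAlgebra K G) := by
  let ψ : G → K →+ (MonoidAlgebra K G →₀ SA K H) := fun g =>
    { toFun := fun a => Finsupp.single (of K G (rep H g))
        (algebraMap K (SA K H) a * ⟨of K G (g * (rep H g)⁻¹), of_mem (rep_mem H g)⟩)
      map_zero' := by simp
      map_add' := fun x y => by rw [map_add, add_mul, Finsupp.single_add] }
  obtain ⟨j, hj⟩ := mkS_gen (K := K) (H := H) (addLift ψ) (by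
    intro h hh m
    change addLift ψ (of K G h * m) = _
    induction m using MonoidAlgebra.induction_linear with
    | zero => simp
    | add x y hx hy => rw [mul_add, map_add, hx, hy, map_add, smul_add]
    | single g a =>
      have e : of K G h * (single g a : MonoidAlgebra K G) = single (h * g) a := by
        rw [of_apply, single_mul_single, one_mul]
      rw [e, addLift_single, addLift_single]
      simp only [ψ, AddMonoidHom.coe_mk, ZeroHom.coe_mk, Finsupp.smul_single]
      simp only [rep_mul H hh]
      congr 1
      apply Subtype.ext
      change algebraMap K (MonoidAlgebra K G) a * of K G (h * g * (rep H g)⁻¹) =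
        of K G h * (algebraMap K (MonoidAlgebra K G) a * of K G (g * (rep H g)⁻¹))
      rw [mul_assoc h, map_mul (of K G), ← mul_assoc, ← mul_assoc, Algebra.commutes])
    (by
    intro k m
    change addLift ψ (algebraMap K (MonoidAlgebra K G) k * m) = _
    induction m using MonoidAlgebra.induction_linear with
    | zero => simp
    | add x y hx hy => rw [mul_add, map_add, hx, hy, map_add, smul_add]
    | single g a =>
      rw [← Algebra.smul_def, smul_single, addLift_single, addLift_single]
      simp only [ψ, AddMonoidHom.coe_mk, ZeroHom.coe_mk, Finsupp.smul_single]
      congr 1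
      rw [smul_eq_mul, smul_eq_mul, map_mul, mul_assoc])
  rw [Module.projective_def]
  refine ⟨j, fun m => ?_⟩
  rw [hj]
  induction m using MonoidAlgebra.induction_linear with
  | zero => simp
  | add x y hx hy => rw [map_add, map_add, hx, hy]
  | single g a =>
    rw [addLift_single]
    simp only [ψ, AddMonoidHom.coe_mk, ZeroHom.coe_mk, Finsupp.linearCombination_single]
    change algebraMap K (MonoidAlgebra K G) a * of K G (g * (rep H g)⁻¹) * of K G (rep H g) = _
    rw [mul_assoc, ← map_mul, inv_mul_cancel_right, ← Algebra.smul_def, of_apply, smul_single]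
    simp

theorem proj_finsupp (H : Subgroup G) (I : Type*) :
    Module.Projective (SA K H) (I →₀ MonoidAlgebra K G) := by
  classical
  have := proj_self (K := K) H
  exact Module.Projective.of_equiv' (finsuppLequivDFinsupp (SA K H)).symm

theorem proj_restrict (H : Subgroup G) (P : Type*) [AddCommGroup P] [Module (MonoidAlgebra K G) P]
    [hP : Module.Projective (MonoidAlgebra K G) P] : Module.Projective (SA K H) P := by
  obtain ⟨s, hs⟩ := Module.projective_def'.1 hP
  have := proj_finsupp (K := K) H P
  refine Module.Projective.of_split (M := P →₀ MonoidAlgebra K G) (s.restrictScalars (SA K H))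
    ((Finsupp.linearCombination (MonoidAlgebra K G) id).restrictScalars (SA K H)) ?_
  ext m
  exact DFunLike.congr_fun hs m

/-- averaging: from an `H`-section to an `H'`-section -/
theorem average [CharZero K] (H H' : Subgroup G) [Finite (H' ⧸ H.subgroupOf H')]
    {M Q : Type*} [AddCommGroup M] [AddCommGroup Q]
    [Module (MonoidAlgebra K G) M] [Module (MonoidAlgebra K G) Q]
    (q : Q →ₗ[MonoidAlgebra K G] M) (j : M →ₗ[SA K H] Q) (hj : ∀ m, q (j m) = m) :
    ∃ j' : M →ₗ[SA K H'] Q, ∀ m, q (j' m) = m := by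
  have := Fintype.ofFinite (H' ⧸ H.subgroupOf H')
  let c : (H' ⧸ H.subgroupOf H') → (M →+ Q) := fun x =>
    Quotient.liftOn x (fun g : H' => cj K (g : G) j.toAddMonoidHom) (by
      intro a b hab
      have hab' : (QuotientGroup.leftRel (H.subgroupOf H')) a b := hab
      rw [QuotientGroup.leftRel_apply, Subgroup.mem_subgroupOf] at hab'
      ext m
      change of K G (a : G) • j (of K G (a : G)⁻¹ • m) = of K G (b : G) • j (of K G (b : G)⁻¹ • m)
      obtain ⟨h, hh, hb⟩ : ∃ h ∈ H, (b : G) = a * h := ⟨_, hab', by simp⟩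
      rw [hb, mul_inv_rev, ← ofmul, ← ofmul (h⁻¹) , S_of j (H.inv_mem hh), ofmul h, mul_inv_cancel,
        ofone])
  have hc : ∀ (g : H') m, c (QuotientGroup.mk g) m = of K G (g : G) • j (of K G (g : G)⁻¹ • m) :=
    fun g m => rfl
  have hqc : ∀ x m, q (c x m) = m := by
    intro x m
    induction x using QuotientGroup.induction_on with
    | H g => rw [hc, map_smul, hj, ofmul, mul_inv_cancel, ofone]
  have hcg : ∀ x (g : H') m, c (g • x) (of K G (g : G) • m) = of K G (g : G) • c x m := by
    intro x g m
    induction x using QuotientGroup.induction_on with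
    | H a =>
      change c (QuotientGroup.mk (g * a)) _ = _
      rw [hc, hc, ofmul, ofmul]
      simp
  have hck : ∀ x (k : K) m, c x (algebraMap K (MonoidAlgebra K G) k • m) =
      algebraMap K (MonoidAlgebra K G) k • c x m := by
    intro x k m
    induction x using QuotientGroup.induction_on with
    | H a => rw [hc, hc, alg_of, S_alg, alg_of]
  set n : K := (Fintype.card (H' ⧸ H.subgroupOf H') : K) with hn
  have hn0 : n ≠ 0 := by
    rw [hn]; exact_mod_cast Fintype.card_ne_zero
  let f : M →+ Q :=
    { toFun := fun m => algebraMap K (MonoidAlgebra K G) n⁻¹ • ∑ x, c x m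
      map_zero' := by simp
      map_add' := fun x y => by simp [Finset.sum_add_distrib] }
  have hf : ∀ m, f m = algebraMap K (MonoidAlgebra K G) n⁻¹ • ∑ x, c x m := fun m => rfl
  obtain ⟨j', hj'⟩ := mkS (K := K) (H := H') f (by
      intro h hh m
      rw [hf, hf]
      rw [alg_of, ← Equiv.sum_comp (MulAction.toPerm (⟨h, hh⟩ : H')), Finset.smul_sum (r := of K G h)]
      congr 1
      refine Finset.sum_congr rfl fun x _ => ?_
      exact hcg x ⟨h, hh⟩ m)
    (by
      intro k m
      rw [hf, hf]
      simp_rw [hck]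
      rw [← Finset.smul_sum, smul_smul, smul_smul, Algebra.commutes])
  refine ⟨j', fun m => ?_⟩
  rw [hj']
  rw [hf, map_smul, map_sum]
  simp_rw [hqc]
  rw [Finset.sum_const, Finset.card_univ, ← Nat.cast_smul_eq_nsmul (MonoidAlgebra K G), smul_smul]
  have : ((Fintype.card (H' ⧸ H.subgroupOf H') : ℕ) : MonoidAlgebra K G) = algebraMap K _ n := by
    simp [hn]
  rw [this, ← map_mul, inv_mul_cancel₀ hn0, map_one, one_smul]

theorem proj_average [CharZero K] (H H' : Subgroup G) [Finite (H' ⧸ H.subgroupOf H')]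
    {M : Type*} [AddCommGroup M] [Module (MonoidAlgebra K G) M]
    [Module.Projective (SA K H) M] : Module.Projective (SA K H') M := by
  let q : (M →₀ MonoidAlgebra K G) →ₗ[MonoidAlgebra K G] M := Finsupp.linearCombination _ id
  have hq : Function.Surjective q := Finsupp.linearCombination_id_surjective _ _
  obtain ⟨j, hj⟩ := Module.projective_lifting_property (q.restrictScalars (SA K H))
    LinearMap.id hq
  obtain ⟨j', hj'⟩ := average H H' q j (fun m => DFunLike.congr_fun hj m)
  have := proj_finsupp (K := K) H' M
  exact Module.Projective.of_split j' (q.restrictScalars (SA K H')) (LinearMap.ext hj')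

theorem proj_top {M : Type*} [AddCommGroup M] [Module (MonoidAlgebra K G) M]
    [Module.Projective (SA K (⊤ : Subgroup G)) M] : Module.Projective (MonoidAlgebra K G) M := by
  let q : (M →₀ MonoidAlgebra K G) →ₗ[MonoidAlgebra K G] M := Finsupp.linearCombination _ id
  have hq : Function.Surjective q := Finsupp.linearCombination_id_surjective _ _
  obtain ⟨j, hj⟩ := Module.projective_lifting_property (q.restrictScalars (SA K (⊤ : Subgroup G)))
    LinearMap.id hq
  have hmem : ∀ x : MonoidAlgebra K G, x ∈ SA K (⊤ : Subgroup G) := by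
    intro x
    induction x using MonoidAlgebra.induction_linear with
    | zero => exact zero_mem _
    | add x y hx hy => exact add_mem hx hy
    | single g a =>
      have : single g a = a • of K G g := by simp [of_apply]
      rw [this]
      exact Subalgebra.smul_mem _ (of_mem (Subgroup.mem_top g)) _
  let j' : M →ₗ[MonoidAlgebra K G] (M →₀ MonoidAlgebra K G) :=
    { j with map_smul' := fun x m => j.map_smul (⟨x, hmem x⟩ : SA K (⊤ : Subgroup G)) m }
  exact Module.Projective.of_split j' q (LinearMap.ext fun m => DFunLike.congr_fun hj m)

/-- Solving `t u t⁻¹ - u = δ` on `R`. -/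
theorem shift_self {H H' : Subgroup G} {t : G} (ht : ∀ h ∈ H, t * h = h * t) (hle : H ≤ H')
    (htH' : t ∈ H') (hH' : ∀ g ∈ H', ∃ k : ℤ, t ^ k * g ∈ H)
    (hinf : ∀ k : ℤ, t ^ k ∈ H → k = 0)
    {L : Type*} [AddCommGroup L] [Module (MonoidAlgebra K G) L]
    (δ : MonoidAlgebra K G →ₗ[SA K H] L) :
    ∃ u : MonoidAlgebra K G →ₗ[SA K H] L, ∀ x,
      of K G t • u (of K G t⁻¹ • x) - u x = δ x := by
  have hex : ∀ g : G, ∃ k : ℤ, t ^ (-k) * (g * (rep H' g)⁻¹) ∈ H := fun g => by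
    obtain ⟨k, hk⟩ := hH' _ (rep_mem H' g)
    exact ⟨-k, by simpa using hk⟩
  choose κ hκ using hex
  have huniq : ∀ (x : G) (k l : ℤ), t ^ (-k) * x ∈ H → t ^ (-l) * x ∈ H → k = l := by
    intro x k l h1 h2
    have h3 := H.mul_mem h1 (H.inv_mem h2)
    have h4 : t ^ (-k) * x * (t ^ (-l) * x)⁻¹ = t ^ (l - k) := by group
    rw [h4] at h3
    have := hinf _ h3
    omega
  have htz : ∀ (k : ℤ), ∀ h ∈ H, t ^ k * h = h * t ^ k := fun k h hh =>
    (Commute.zpow_left (show Commute t h from ht h hh) k)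
  have hκH : ∀ h ∈ H, ∀ g, κ (h * g) = κ g := by
    intro h hh g
    refine huniq (h * g * (rep H' g)⁻¹) _ _ ?_ ?_
    · have := hκ (h * g)
      rwa [rep_mul H' (hle hh)] at this
    · rw [mul_assoc h, ← mul_assoc, htz _ h hh, mul_assoc]
      exact H.mul_mem hh (hκ g)
  have hκt : ∀ g, κ (t⁻¹ * g) = κ g - 1 := by
    intro g
    refine huniq (t⁻¹ * g * (rep H' g)⁻¹) _ _ ?_ ?_
    · have := hκ (t⁻¹ * g)
      rwa [rep_mul H' (H'.inv_mem htH')] at this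
    · have := hκ g
      have e : t ^ (-(κ g - 1)) * (t⁻¹ * g * (rep H' g)⁻¹) = t ^ (-κ g) * (g * (rep H' g)⁻¹) := by
        group
      rwa [e]
  have ht' : ∀ h ∈ H, t⁻¹ * h = h * t⁻¹ := fun h hh => by simpa using htz (-1) h hh
  let Φ : Equiv.Perm (MonoidAlgebra K G →ₗ[SA K H] L) :=
    { toFun := fun U => conj ht U - δ
      invFun := fun U => conj ht' (U + δ)
      left_inv := fun U => by
        ext1 x
        rw [conj_apply, sub_add_cancel, conj_apply, ofmul, ofmul, inv_inv, inv_mul_cancel, ofone,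
          ofone]
      right_inv := fun U => by
        ext1 x
        rw [LinearMap.sub_apply, conj_apply, conj_apply, ofmul, ofmul, inv_inv, mul_inv_cancel,
          ofone, ofone, LinearMap.add_apply, add_sub_cancel_right] }
  let U : ℤ → (MonoidAlgebra K G →ₗ[SA K H] L) := fun k => (Φ ^ k) 0
  have hU : ∀ k x, of K G t • U (k - 1) (of K G t⁻¹ • x) = U k x + δ x := by
    intro k x
    have : U k = Φ (U (k - 1)) := by
      change (Φ ^ k) 0 = Φ ((Φ ^ (k - 1)) 0)
      rw [← Equiv.Perm.mul_apply, ← zpow_one_add]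
      congr 2
      omega
    rw [this]
    change _ = (conj ht (U (k - 1)) - δ) x + δ x
    rw [LinearMap.sub_apply, conj_apply, sub_add_cancel]
  let ψ : G → K →+ L := fun g =>
    { toFun := fun a => U (κ g) (single g a)
      map_zero' := by simp
      map_add' := fun x y => by simp [single_add] }
  have hψ : ∀ g a, addLift ψ (single g a) = U (κ g) (single g a) := fun g a => addLift_single ψ g a
  obtain ⟨u, hu⟩ := mkS (K := K) (H := H) (addLift ψ) (by
    intro h hh m
    induction m using MonoidAlgebra.induction_linear with
    | zero => simp
    | add x y hx hy => rw [smul_add, map_add, hx, hy, map_add, smul_add]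
    | single g a =>
      have e : of K G h • (single g a : MonoidAlgebra K G) = single (h * g) a := by
        rw [smul_eq_mul, of_apply, single_mul_single, one_mul]
      rw [hψ, ← S_of _ hh, e, hψ, hκH h hh])
    (by
    intro k m
    induction m using MonoidAlgebra.induction_linear with
    | zero => simp
    | add x y hx hy => rw [smul_add, map_add, hx, hy, map_add, smul_add]
    | single g a =>
      have e : algebraMap K (MonoidAlgebra K G) k • (single g a : MonoidAlgebra K G) =
          single g (k * a) := by
        rw [smul_eq_mul, ← Algebra.smul_def, smul_single, smul_eq_mul]
      rw [hψ, ← S_alg, e, hψ])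
  refine ⟨u, fun x => ?_⟩
  rw [hu, hu]
  induction x using MonoidAlgebra.induction_linear with
  | zero => simp
  | add x y hx hy => rw [smul_add, map_add, map_add, map_add, ← hx, ← hy, smul_add]; abel
  | single g a =>
    have e : of K G t⁻¹ • (single g a : MonoidAlgebra K G) = single (t⁻¹ * g) a := by
      rw [smul_eq_mul, of_apply, single_mul_single, one_mul]
    rw [hψ]
    have h1 := hU (κ g) (single g a)
    rw [e] at h1 ⊢
    rw [hψ, hκt, h1]
    abel

/-- Solving `t u t⁻¹ - u = δ` on a projective module. -/
theorem shift_proj {H H' : Subgroup G} {t : G} (ht : ∀ h ∈ H, t * h = h * t) (hle : H ≤ H')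
    (htH' : t ∈ H') (hH' : ∀ g ∈ H', ∃ k : ℤ, t ^ k * g ∈ H)
    (hinf : ∀ k : ℤ, t ^ k ∈ H → k = 0)
    {P : Type*} [AddCommGroup P] [Module (MonoidAlgebra K G) P]
    [hP : Module.Projective (MonoidAlgebra K G) P]
    {L : Type*} [AddCommGroup L] [Module (MonoidAlgebra K G) L]
    (δ : P →ₗ[SA K H] L) :
    ∃ u : P →ₗ[SA K H] L, ∀ x, of K G t • u (of K G t⁻¹ • x) - u x = δ x := by
  obtain ⟨s, hs⟩ := Module.projective_def'.1 hP
  let q : (P →₀ MonoidAlgebra K G) →ₗ[MonoidAlgebra K G] P := Finsupp.linearCombination _ id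
  have hs' : ∀ p, q (s p) = p := fun p => DFunLike.congr_fun hs p
  have key : ∀ p : P, ∃ u : MonoidAlgebra K G →ₗ[SA K H] L, ∀ x,
      of K G t • u (of K G t⁻¹ • x) - u x = δ (q (Finsupp.single p x)) := fun p =>
    shift_self ht hle htH' hH' hinf
      (δ ∘ₗ (q.restrictScalars (SA K H)) ∘ₗ (Finsupp.lsingle p))
  choose u hu using key
  let v : (P →₀ MonoidAlgebra K G) →ₗ[SA K H] L := Finsupp.lsum ℕ u
  have hv : ∀ p x, v (Finsupp.single p x) = u p x := fun p x => by simp [v]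
  have hv' : ∀ y, of K G t • v (of K G t⁻¹ • y) - v y = δ (q y) := by
    intro y
    induction y using Finsupp.induction_linear with
    | zero => simp
    | add x y hx hy =>
      rw [smul_add, map_add, map_add, map_add, map_add, ← hx, ← hy, smul_add]; abel
    | single p x => rw [Finsupp.smul_single, hv, hv, hu]
  refine ⟨v ∘ₗ s.restrictScalars (SA K H), fun x => ?_⟩
  have := hv' (s x)
  rw [hs'] at this
  simpa using this

/-- key step -/
theorem step_inf {H H' : Subgroup G} {t : G} (ht : ∀ h ∈ H, t * h = h * t) (hle : H ≤ H')
    (htH' : t ∈ H') (hH' : ∀ g ∈ H', ∃ k : ℤ, t ^ k * g ∈ H)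
    (hinf : ∀ k : ℤ, t ^ k ∈ H → k = 0)
    {P M : Type*} [AddCommGroup P] [Module (MonoidAlgebra K G) P]
    [hP : Module.Projective (MonoidAlgebra K G) P]
    [AddCommGroup M] [Module (MonoidAlgebra K G) M] [Module.Projective (SA K H) M]
    (f : P →ₗ[MonoidAlgebra K G] M) (hf : Function.Surjective f) :
    Module.Projective (SA K H') (LinearMap.ker f) := by
  have hPS := proj_restrict (K := K) H P
  obtain ⟨s, hs⟩ := Module.projective_lifting_property (f.restrictScalars (SA K H))
    LinearMap.id hf
  have hs' : ∀ m, f (s m) = m := fun m => DFunLike.congr_fun hs m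
  let ρ : P →ₗ[SA K H] LinearMap.ker f :=
    { toFun := fun p => ⟨p - s (f p), by rw [LinearMap.mem_ker, map_sub, hs', sub_self]⟩
      map_add' := fun x y => Subtype.ext (by
        change x + y - s (f (x + y)) = (x - s (f x)) + (y - s (f y))
        rw [map_add, map_add]; abel)
      map_smul' := fun a x => Subtype.ext (by
        change a • x - s (f ((a : MonoidAlgebra K G) • x)) = a • (x - s (f x))
        have h1 : f ((a : MonoidAlgebra K G) • x) = a • f x := f.map_smul _ x
        rw [h1, map_smul, smul_sub]) }
  let ι : LinearMap.ker f →ₗ[SA K H] P := (LinearMap.ker f).subtype.restrictScalars (SA K H)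
  have hρ : ∀ w : LinearMap.ker f, ρ (ι w) = w := fun w => Subtype.ext (by
    change (w : P) - s (f w) = w
    rw [LinearMap.mem_ker.1 w.2, map_zero, sub_zero])
  have hΩ : Module.Projective (SA K H) (LinearMap.ker f) :=
    Module.Projective.of_split ι ρ (LinearMap.ext hρ)
  let q : (LinearMap.ker f →₀ MonoidAlgebra K G) →ₗ[MonoidAlgebra K G] LinearMap.ker f :=
    Finsupp.linearCombination _ id
  have hq : Function.Surjective q := Finsupp.linearCombination_id_surjective _ _
  obtain ⟨j, hj⟩ := Module.projective_lifting_property (q.restrictScalars (SA K H))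
    LinearMap.id hq
  have hj' : ∀ m, q (j m) = m := fun m => DFunLike.congr_fun hj m
  let δ0 : LinearMap.ker f →ₗ[SA K H] (LinearMap.ker f →₀ MonoidAlgebra K G) := conj ht j - j
  have hδ0 : ∀ w, δ0 w = of K G t • j (of K G t⁻¹ • w) - j w := fun w => by
    rw [← conj_apply ht]; rfl
  let δ : LinearMap.ker f →ₗ[SA K H] LinearMap.ker q :=
    { toFun := fun w => ⟨δ0 w, by
        rw [LinearMap.mem_ker, hδ0, map_sub, map_smul, hj', hj', ofmul, mul_inv_cancel, ofone,
          sub_self]⟩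
      map_add' := fun x y => Subtype.ext (map_add δ0 x y)
      map_smul' := fun a x => Subtype.ext (δ0.map_smul a x) }
  obtain ⟨u, hu⟩ := shift_proj (L := LinearMap.ker q) ht hle htH' hH' hinf (δ ∘ₗ ρ)
  have hu' : ∀ w : LinearMap.ker f, of K G t • (u (ι (of K G t⁻¹ • w)) : _ →₀ _) -
      (u (ι w) : _ →₀ _) = of K G t • j (of K G t⁻¹ • w) - j w := by
    intro w
    have h1 := congrArg Subtype.val (hu (ι w))
    rw [← hδ0]
    have h2 : (δ ∘ₗ ρ) (ι w) = δ w := by rw [LinearMap.comp_apply, hρ]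
    rw [h2] at h1
    exact h1
  let v : LinearMap.ker f →ₗ[SA K H] (LinearMap.ker f →₀ MonoidAlgebra K G) :=
    j - (((LinearMap.ker q).subtype.restrictScalars (SA K H)) ∘ₗ u ∘ₗ ι)
  have hv : ∀ w, v w = j w - (u (ι w) : _ →₀ _) := fun w => rfl
  have hvt : ∀ w, v (of K G t⁻¹ • w) = of K G t⁻¹ • v w := by
    intro w
    have h1 : of K G t • v (of K G t⁻¹ • w) = v w := by
      rw [hv, hv, smul_sub]
      have := hu' w
      rw [sub_eq_sub_iff_add_eq_add] at this ⊢
      rw [add_comm, add_comm (j w), add_comm, ← this, add_comm]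
    rw [← h1, ofmul, inv_mul_cancel, ofone]
  have hvt' : ∀ w, v (of K G t • w) = of K G t • v w := by
    intro w
    have h1 := hvt (of K G t • w)
    rw [ofmul, inv_mul_cancel, ofone] at h1
    rw [h1, ofmul, mul_inv_cancel, ofone]
  let B : Subgroup G :=
    { carrier := {g | ∀ w, v (of K G g • w) = of K G g • v w}
      one_mem' := fun w => by rw [ofone, ofone]
      mul_mem' := fun {a b} ha hb w => by rw [← ofmul, ha, hb, ofmul]
      inv_mem' := fun {a} ha w => by
        have h1 := ha (of K G a⁻¹ • w)
        rw [ofmul, mul_inv_cancel, ofone] at h1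
        rw [h1, ofmul, inv_mul_cancel, ofone] }
  have hB : H' ≤ B := by
    intro g hg
    obtain ⟨k, hk⟩ := hH' g hg
    have h1 : t ^ k * g ∈ B := fun w => S_of v hk w
    have h2 : t ^ k ∈ B := B.zpow_mem hvt' k
    exact (B.mul_mem_cancel_left h2).1 h1
  obtain ⟨v', hv'⟩ := mkS (K := K) (H := H') v.toAddMonoidHom (fun h hh => hB hh)
    (fun k m => S_alg v k m)
  have := proj_finsupp (K := K) H' (LinearMap.ker f)
  refine Module.Projective.of_split v' (q.restrictScalars (SA K H')) (LinearMap.ext fun w => ?_)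
  change q (v' w) = w
  rw [hv']
  change q (v w) = w
  rw [hv, map_sub, hj', LinearMap.mem_ker.1 (u (ι w)).2, sub_zero]

theorem step [CharZero K] {H H' : Subgroup G} {t : G} (ht : ∀ h ∈ H, t * h = h * t) (hle : H ≤ H')
    (htH' : t ∈ H') (hH' : ∀ g ∈ H', ∃ k : ℤ, t ^ k * g ∈ H)
    {P M : Type*} [AddCommGroup P] [Module (MonoidAlgebra K G) P]
    [hP : Module.Projective (MonoidAlgebra K G) P]
    [AddCommGroup M] [Module (MonoidAlgebra K G) M] [Module.Projective (SA K H) M]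
    (f : P →ₗ[MonoidAlgebra K G] M) (hf : Function.Surjective f) :
    Module.Projective (SA K H') (LinearMap.ker f) := by
  by_cases hinf : ∀ k : ℤ, t ^ k ∈ H → k = 0
  · exact step_inf ht hle htH' hH' hinf f hf
  · push Not at hinf
    obtain ⟨k, hk, hk0⟩ := hinf
    have hfin : Finite (H' ⧸ H.subgroupOf H') := by
      let φ : Set.Ico (0 : ℤ) |k| → (H' ⧸ H.subgroupOf H') :=
        fun i => QuotientGroup.mk ((⟨t, htH'⟩ : H') ^ (i : ℤ))
      refine Finite.of_surjective φ fun x => ?_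
      induction x using QuotientGroup.induction_on with
      | H g =>
        obtain ⟨l, hl⟩ := hH' g g.2
        refine ⟨⟨(-l) % k, Int.emod_nonneg _ hk0, Int.emod_lt_abs _ hk0⟩, ?_⟩
        apply QuotientGroup.eq.2
        rw [Subgroup.mem_subgroupOf]
        simp only [Subgroup.coe_mul, Subgroup.coe_inv, Subgroup.coe_zpow]
        have e : (t ^ (-l % k))⁻¹ * (g : G) = (t ^ k) ^ ((-l) / k) * (t ^ l * g) := by
          rw [← zpow_neg, ← zpow_mul, ← mul_assoc, ← zpow_add]
          congr 2
          have := Int.emod_add_mul_ediv (-l) k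
          omega
        rw [e]
        exact H.mul_mem (H.zpow_mem hk _) hl
    have : Module.Projective (SA K H') M := proj_average H H'
    have hPS := proj_restrict (K := K) H' P
    obtain ⟨s, hs⟩ := Module.projective_lifting_property (f.restrictScalars (SA K H'))
      LinearMap.id hf
    have hs' : ∀ m, f (s m) = m := fun m => DFunLike.congr_fun hs m
    let ρ : P →ₗ[SA K H'] LinearMap.ker f :=
      { toFun := fun p => ⟨p - s (f p), by rw [LinearMap.mem_ker, map_sub, hs', sub_self]⟩
        map_add' := fun x y => Subtype.ext (by
          change x + y - s (f (x + y)) = (x - s (f x)) + (y - s (f y))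
          rw [map_add, map_add]; abel)
        map_smul' := fun a x => Subtype.ext (by
          change a • x - s (f ((a : MonoidAlgebra K G) • x)) = a • (x - s (f x))
          have h1 : f ((a : MonoidAlgebra K G) • x) = a • f x := f.map_smul _ x
          rw [h1, map_smul, smul_sub]) }
    refine Module.Projective.of_split ((LinearMap.ker f).subtype.restrictScalars (SA K H')) ρ
      (LinearMap.ext fun w => Subtype.ext ?_)
    change (w : P) - s (f w) = w
    rw [LinearMap.mem_ker.1 w.2, map_zero, sub_zero]

theorem proj_bot {M : Type*} [AddCommGroup M] [Module (MonoidAlgebra K G) M] :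
    Module.Projective (SA K (⊥ : Subgroup G)) M := by
  let q : (M →₀ MonoidAlgebra K G) →ₗ[MonoidAlgebra K G] M := Finsupp.linearCombination _ id
  have hq : Function.Surjective q := Finsupp.linearCombination_id_surjective _ _
  have : ∃ j : M →+ (M →₀ MonoidAlgebra K G), (∀ m, q (j m) = m) ∧
      ∀ (k : K) m, j (algebraMap K (MonoidAlgebra K G) k • m) =
        algebraMap K (MonoidAlgebra K G) k • j m := by
    let i1 : Module K M := Module.compHom M (algebraMap K (MonoidAlgebra K G))
    let i2 : Module K (M →₀ MonoidAlgebra K G) :=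
      Module.compHom _ (algebraMap K (MonoidAlgebra K G))
    let q' : (M →₀ MonoidAlgebra K G) →ₗ[K] M :=
      { toFun := q
        map_add' := map_add q
        map_smul' := fun k m => q.map_smul (algebraMap K (MonoidAlgebra K G) k) m }
    obtain ⟨j, hj⟩ := Module.projective_lifting_property q' LinearMap.id hq
    exact ⟨j.toAddMonoidHom, fun m => DFunLike.congr_fun hj m, fun k m => j.map_smul k m⟩
  obtain ⟨j, hj, hk⟩ := this
  obtain ⟨j', hj'⟩ := mkS (K := K) (H := (⊥ : Subgroup G)) j (by
    intro h hh m
    rw [Subgroup.mem_bot] at hh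
    subst hh
    rw [ofone, ofone]) hk
  have := proj_finsupp (K := K) (⊥ : Subgroup G) M
  refine Module.Projective.of_split j' (q.restrictScalars _) (LinearMap.ext fun m => ?_)
  change q (j' m) = m
  rw [hj', hj]

universe v

theorem pd_subsingleton {R : Type*} [Ring R] (d : ℕ) : ∀ (M : ModuleCat.{v} R), Subsingleton M →
    pdLE R d M := by
  induction d with
  | zero =>
    intro M hM
    change Module.Projective R M
    infer_instance
  | succ d ih =>
    intro M hM
    refine ⟨M, LinearMap.id, inferInstance, Function.surjective_id, ih _ ?_⟩
    change Subsingleton (LinearMap.ker _)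
    infer_instance

theorem small_alg [Countable G] (M : Type v) [AddCommGroup M] [Module (MonoidAlgebra K G) M]
    [Nontrivial M] : Small.{v} (MonoidAlgebra K G) := by
  obtain ⟨m, hm⟩ := exists_ne (0 : M)
  have hK : Small.{v} K := by
    refine small_of_injective (β := M) (f := fun k => algebraMap K (MonoidAlgebra K G) k • m) ?_
    intro a b hab
    by_contra hne
    have h0 : algebraMap K (MonoidAlgebra K G) (a - b) • m = 0 := by
      rw [map_sub, sub_smul]; exact sub_eq_zero.2 hab
    have h1 := congrArg (fun x => algebraMap K (MonoidAlgebra K G) (a - b)⁻¹ • x) h0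
    simp only [smul_zero] at h1
    rw [smul_smul, ← map_mul, inv_mul_cancel₀ (sub_ne_zero.2 hne), map_one, one_smul] at h1
    exact hm h1
  refine small_of_injective (β := G → K) (f := fun x g => x.coeff g) ?_
  intro x y h
  ext g
  exact congrFun h g

theorem exists_cover [Countable G] (M : ModuleCat.{v} (MonoidAlgebra K G)) [Nontrivial M] :
    ∃ (P : ModuleCat.{v} (MonoidAlgebra K G)) (f : P →ₗ[MonoidAlgebra K G] M),
      Module.Projective (MonoidAlgebra K G) P ∧ Function.Surjective f := by
  have := small_alg (K := K) (G := G) M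
  have : Small.{v} (M →₀ MonoidAlgebra K G) :=
    small_of_injective (β := M → MonoidAlgebra K G) DFunLike.coe_injective
  refine ⟨ModuleCat.of _ (Shrink.{v} (M →₀ MonoidAlgebra K G)),
    (Finsupp.linearCombination _ id) ∘ₗ (Shrink.linearEquiv (MonoidAlgebra K G) _).toLinearMap,
    ?_, ?_⟩
  · change Module.Projective _ (Shrink.{v} (M →₀ MonoidAlgebra K G))
    infer_instance
  · exact (Finsupp.linearCombination_id_surjective _ _).comp
      (Shrink.linearEquiv (MonoidAlgebra K G) _).surjective

theorem chain [CharZero K] [Countable G] (A : Subgroup G) [A.FiniteIndex]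
    (hA : ∀ a ∈ A, ∀ b ∈ A, a * b = b * a) (l : List G) :
    ∀ T : Set G, Subgroup.closure (T ∪ {x | x ∈ l}) = A →
      ∀ M : ModuleCat.{v} (MonoidAlgebra K G),
        Module.Projective (SA K (Subgroup.closure T)) M →
        pdLE (MonoidAlgebra K G) l.length M := by
  induction l with
  | nil =>
    intro T hT M hM
    have hT' : Subgroup.closure T = A := by simpa using hT
    rw [hT'] at hM
    have : Finite ((⊤ : Subgroup G) ⧸ A.subgroupOf ⊤) := inferInstance
    have := proj_average (K := K) A ⊤ (M := M)
    exact proj_top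
  | cons t l ih =>
    intro T hT M hM
    rcases subsingleton_or_nontrivial M with hs | hn
    · exact pd_subsingleton _ M hs
    obtain ⟨P, f, hP, hf⟩ := exists_cover M
    refine ⟨P, f, hP, hf, ih (insert t T) ?_ _ ?_⟩
    · rw [← hT]
      congr 1
      ext x
      simp only [Set.mem_union, Set.mem_insert_iff, Set.mem_ofPred_eq, List.mem_cons]
      tauto
    · have hsub : Subgroup.closure T ≤ A := by
        rw [← hT]; exact Subgroup.closure_mono Set.subset_union_left
      have htA : t ∈ A := by
        rw [← hT]; exact Subgroup.subset_closure (Or.inr (by simp))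
      have ht : ∀ h ∈ Subgroup.closure T, t * h = h * t := fun h hh => hA _ htA _ (hsub hh)
      refine step (K := K) (H := Subgroup.closure T) (t := t) ht
        (Subgroup.closure_mono (Set.subset_insert _ _))
        (Subgroup.subset_closure (Set.mem_insert _ _)) ?_ f hf
      intro g hg
      have htz : ∀ (k : ℤ), ∀ h ∈ Subgroup.closure T, t ^ k * h = h * t ^ k := fun k h hh =>
        (Commute.zpow_left (show Commute t h from ht h hh) k)
      induction hg using Subgroup.closure_induction with
      | mem x hx =>
        rcases hx with rfl | hx
        · exact ⟨-1, by simp [one_mem]⟩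
        · exact ⟨0, by simpa using Subgroup.subset_closure hx⟩
      | one => exact ⟨0, by simp [one_mem]⟩
      | mul x y _ _ h1 h2 =>
        obtain ⟨a, ha⟩ := h1
        obtain ⟨b, hb⟩ := h2
        refine ⟨b + a, ?_⟩
        have e : t ^ (b + a) * (x * y) = (t ^ a * x) * (t ^ b * y) := by
          have h3 := htz b _ ha
          calc t ^ (b + a) * (x * y) = (t ^ b * (t ^ a * x)) * y := by rw [zpow_add]; group
            _ = _ := by rw [h3]; group
        rw [e]
        exact mul_mem ha hb
      | inv x _ h1 =>
        obtain ⟨a, ha⟩ := h1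
        refine ⟨-a, ?_⟩
        have h3 := htz (-a) _ (inv_mem ha)
        have e : t ^ (-a) * x⁻¹ = (t ^ a * x)⁻¹ := by
          have e1 : (t ^ a * x)⁻¹ * t ^ a = x⁻¹ := by group
          rw [← e1, ← mul_assoc, h3]; group
        rw [e]
        exact inv_mem ha

theorem virtually_abelian [CharZero K] [Countable G] [Group.FG G] (A : Subgroup G) [A.FiniteIndex]
    (hA : ∀ a ∈ A, ∀ b ∈ A, a * b = b * a) :
    ∃ d : ℕ, ∀ M : ModuleCat.{v} (MonoidAlgebra K G), pdLE (MonoidAlgebra K G) d M := by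
  have hfg : Group.FG A := inferInstance
  rw [Group.fg_iff_subgroup_fg] at hfg
  obtain ⟨S, hS⟩ := hfg
  refine ⟨S.toList.length, fun M => chain A hA S.toList ∅ ?_ M ?_⟩
  · rw [← hS]; congr 1; ext x; simp
  · rw [Subgroup.closure_empty]; exact proj_bot

end alg

section yb

variable {X : Type*} (r : X × X → X × X)

theorem sig_sig (hinv : Function.Involutive r) (x y : X) :
    sig r (sig r x y) (tau r y x) = x := by
  have := hinv (x, y)
  exact congrArg Prod.fst this

theorem tau_tau (hinv : Function.Involutive r) (x y : X) :
    tau r (tau r y x) (sig r x y) = y := by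
  have := hinv (x, y)
  exact congrArg Prod.snd this

theorem sig_comp (hbr : IsBraided r) (x y z : X) :
    sig r (sig r x y) (sig r (tau r y x) z) = sig r x (sig r y z) := by
  have h := congrFun hbr (x, y, z)
  exact congrArg (fun p : X × X × X => p.1) h

/-- `σ_x` as a permutation -/
noncomputable def sp (hnd : Nondegenerate r) (x : X) : Equiv.Perm X :=
  Equiv.ofBijective (sig r x) (hnd.1 x)

/-- The action of `G` on `X`. -/
noncomputable def lam (hnd : Nondegenerate r) (hbr : IsBraided r) : YBGroup r →* Equiv.Perm X :=
  PresentedGroup.toGroup (f := sp r hnd) (by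
    rintro w ⟨x, y, rfl⟩
    rw [map_mul, map_mul, map_inv, map_mul, mul_inv_eq_one]
    simp only [FreeGroup.lift_apply_of]
    ext z
    exact (sig_comp r hbr x y z).symm)

theorem lam_of (hnd : Nondegenerate r) (hbr : IsBraided r) (x y : X) :
    lam r hnd hbr (ybι r x) y = sig r x y := by
  unfold lam ybι
  rw [PresentedGroup.toGroup.of]
  rfl

theorem rel (x y : X) : ybι r x * ybι r y = ybι r (sig r x y) * ybι r (tau r y x) := by
  rw [← mul_inv_eq_one]
  exact PresentedGroup.one_of_mem (rels := ybRels r) ⟨x, y, rfl⟩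

theorem diag_bij [Finite X] (hnd : Nondegenerate r) (hinv : Function.Involutive r) :
    Function.Bijective (fun z => (sp r hnd z)⁻¹ z) := by
  apply Function.Surjective.bijective_of_finite
  intro z
  obtain ⟨w, hw⟩ := (hnd.2 z).2 z
  refine ⟨w, ?_⟩
  have h2 := tau_tau r hinv w z
  rw [hw] at h2
  have h3 : sig r w z = w := (hnd.2 z).1 (h2.trans hw.symm)
  change (sp r hnd w)⁻¹ w = z
  rw [Equiv.Perm.inv_eq_iff_eq]
  exact h3.symm

theorem ker_comm [Finite X] (hnd : Nondegenerate r) (hinv : Function.Involutive r)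
    (hbr : IsBraided r) :
    ∀ a ∈ (lam r hnd hbr).ker, ∀ b ∈ (lam r hnd hbr).ker, a * b = b * a := by
  set lm := lam r hnd hbr with hlm
  have hof : ∀ x, lm (ybι r x) = sp r hnd x := fun x => Equiv.ext (lam_of r hnd hbr x)
  have hdiag := diag_bij r hnd hinv
  let T0 : X → YBGroup r → YBGroup r := fun x g => g * ybι r ((lm g)⁻¹ x)
  have hT0inv : ∀ x g, (lm (T0 x g))⁻¹ x =
      (sp r hnd ((lm g)⁻¹ x))⁻¹ ((lm g)⁻¹ x) := by
    intro x g
    change (lm (g * ybι r ((lm g)⁻¹ x)))⁻¹ x = _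
    rw [map_mul, hof, mul_inv_rev, Equiv.Perm.mul_apply]
  have hbij : ∀ x, Function.Bijective (T0 x) := by
    intro x
    constructor
    · intro g h hgh
      have h1 := hT0inv x g
      rw [hgh, hT0inv x h] at h1
      have h2 := hdiag.1 h1
      have h3 : g * ybι r ((lm g)⁻¹ x) = h * ybι r ((lm h)⁻¹ x) := hgh
      rw [h2] at h3
      exact mul_right_cancel h3
    · intro h
      obtain ⟨z, hz⟩ := hdiag.2 ((lm h)⁻¹ x)
      refine ⟨h * (ybι r z)⁻¹, ?_⟩
      have hz' : (sp r hnd z)⁻¹ z = (lm h)⁻¹ x := hz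
      have : (lm (h * (ybι r z)⁻¹))⁻¹ x = z := by
        rw [map_mul, map_inv, hof, mul_inv_rev, Equiv.Perm.mul_apply, ← hz', inv_inv]
        simp
      change h * (ybι r z)⁻¹ * ybι r ((lm (h * (ybι r z)⁻¹))⁻¹ x) = h
      rw [this]
      simp
  have hcomm0 : ∀ x y g, T0 x (T0 y g) = T0 y (T0 x g) := by
    intro x y g
    have key : ∀ a b : X, ybι r b * ybι r ((sp r hnd b)⁻¹ a) = ybι r a * ybι r ((sp r hnd a)⁻¹ b) := by
      intro a b
      rw [rel]
      have h1 : sig r b ((sp r hnd b)⁻¹ a) = a := (sp r hnd b).apply_symm_apply a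
      have h2 := sig_sig r hinv b ((sp r hnd b)⁻¹ a)
      rw [h1] at h2 ⊢
      congr 2
      rw [Equiv.Perm.eq_inv_iff_eq]
      exact h2
    have hform : ∀ x y g, T0 x (T0 y g) = g * (ybι r ((lm g)⁻¹ y) *
        ybι r ((sp r hnd ((lm g)⁻¹ y))⁻¹ ((lm g)⁻¹ x))) := by
      intro x y g
      change g * ybι r ((lm g)⁻¹ y) * ybι r ((lm (g * ybι r ((lm g)⁻¹ y)))⁻¹ x) = _
      rw [map_mul, hof, mul_inv_rev, Equiv.Perm.mul_apply, mul_assoc]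
    rw [hform, hform, key]
  let T : X → Equiv.Perm (YBGroup r) := fun x => Equiv.ofBijective (T0 x) (hbij x)
  have hT : ∀ x g, T x g = g * ybι r ((lm g)⁻¹ x) := fun x g => rfl
  let C : Subgroup (Equiv.Perm (YBGroup r)) := Subgroup.closure (Set.range T)
  have hCcomm : ∀ c ∈ C, ∀ d ∈ C, c * d = d * c := by
    intro c hc d hd
    have := Subgroup.isMulCommutative_closure (k := Set.range T) (by
      rintro _ ⟨x, rfl⟩ _ ⟨y, rfl⟩
      exact Equiv.ext (hcomm0 x y))
    exact congrArg Subtype.val (this.is_comm.comm (⟨c, hc⟩ : C) ⟨d, hd⟩)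
  have htrans : ∀ g, ∃ c ∈ C, c 1 = g := by
    intro g
    have hg : g ∈ Subgroup.closure (Set.range (ybι r)) := by
      have := PresentedGroup.closure_range_of (ybRels r)
      change g ∈ Subgroup.closure (Set.range PresentedGroup.of)
      rw [this]; trivial
    induction hg using Subgroup.closure_induction_right with
    | one => exact ⟨1, one_mem _, rfl⟩
    | mul_right g hg y hy ih =>
      obtain ⟨x, rfl⟩ := hy
      obtain ⟨c, hc, rfl⟩ := ih
      refine ⟨T (lm (c 1) x) * c, mul_mem (Subgroup.subset_closure ⟨_, rfl⟩) hc, ?_⟩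
      rw [Equiv.Perm.mul_apply, hT]
      simp
    | mul_inv_cancel g hg y hy ih =>
      obtain ⟨x, rfl⟩ := hy
      obtain ⟨c, hc, rfl⟩ := ih
      refine ⟨(T (lm (c 1 * (ybι r x)⁻¹) x))⁻¹ * c,
        mul_mem (inv_mem (Subgroup.subset_closure ⟨_, rfl⟩)) hc, ?_⟩
      rw [Equiv.Perm.mul_apply, Equiv.Perm.inv_eq_iff_eq, hT]
      simp
  have hL : ∀ a ∈ lm.ker, ∀ c ∈ C, ∀ g, c (a * g) = a * c g := by
    intro a ha c hc
    rw [MonoidHom.mem_ker] at ha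
    induction hc using Subgroup.closure_induction with
    | mem c hc =>
      obtain ⟨x, rfl⟩ := hc
      intro g
      rw [hT, hT, map_mul, ha, one_mul, mul_assoc]
    | one => intro g; rfl
    | mul c d _ _ h1 h2 =>
      intro g
      rw [Equiv.Perm.mul_apply, h2, h1]; rfl
    | inv c _ h1 =>
      intro g
      rw [Equiv.Perm.inv_eq_iff_eq, h1]
      simp
  intro a ha b hb
  obtain ⟨c, hc, hca⟩ := htrans a
  obtain ⟨d, hd, hdb⟩ := htrans b
  have h1 : a * b = d (c 1) := by
    rw [hca, ← hdb, ← hL a ha d hd, mul_one]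
  have h2 : b * a = c (d 1) := by
    rw [hdb, ← hca, ← hL b hb c hc, mul_one]
  rw [h1, h2]
  exact DFunLike.congr_fun (hCcomm d hd c hc) 1

end yb

end YBAux

/-- For a finite nondegenerate involutive braided set
`(X,r)` and a field `K` of characteristic `0`, the group algebra `K[G(X,r)]`
has finite global dimension: there is a `d : ℕ` such that every
`K[G]`-module has projective dimension at most `d`. -/
theorem groupAlgebra_finite_global_dimension {X : Type*} [Fintype X]
    (r : X × X → X × X)
    (hnd : Nondegenerate r) (hinv : Function.Involutive r) (hbr : IsBraided r)
    (K : Type*) [Field K] (hchar : CharZero K) :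
    ∃ d : ℕ, ∀ M : ModuleCat (MonoidAlgebra K (YBGroup r)),
      pdLE (MonoidAlgebra K (YBGroup r)) d M := by
  have hfin : Finite X := inferInstance
  have := hchar
  have hc : Countable (YBGroup r) := by
    have : Countable (FreeGroup X) := by
      unfold FreeGroup; infer_instance
    exact (QuotientGroup.mk'_surjective _).countable
  have hfg : Group.FG (YBGroup r) := by
    rw [Group.fg_iff]
    exact ⟨Set.range PresentedGroup.of, PresentedGroup.closure_range_of _, Set.finite_range _⟩
  exact YBAux.virtually_abelian (YBAux.lam r hnd hbr).ker (YBAux.ker_comm r hnd hinv hbr)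
end

section
/- Let (X,r) be a square-free solution of finite order. Then the group G = G(X,r) is a finitely generated, torsion-free (g^k = 1 with k ≥ 1 implies g = 1), solvable group which is abelian-by-finite: G contains an abelian normal subgroup of finite index. -/
section Aux

open Polynomial
universe u v


lemma cx_norm_sum_le (s : Multiset ℂ) (h1 : ∀ z ∈ s, ‖z‖ = 1) : ‖s.sum‖ ≤ Multiset.card s := by
  induction s using Multiset.induction with
  | empty => simp
  | cons a s ih =>
    have := ih (fun z hz => h1 z (Multiset.mem_cons_of_mem hz))
    have ha := h1 a (Multiset.mem_cons_self a s)
    simp only [Multiset.sum_cons, Multiset.card_cons, Nat.cast_add, Nat.cast_one]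
    linarith [norm_add_le a s.sum]

lemma cx_norm_sum_lt (s : Multiset ℂ) (h1 : ∀ z ∈ s, ‖z‖ = 1) (a b : ℂ) (ha : a ∈ s) (hb : b ∈ s)
    (hab : a ≠ b) : ‖s.sum‖ < Multiset.card s := by
  obtain ⟨t, rfl⟩ := Multiset.exists_cons_of_mem ha
  have hb' : b ∈ t := by
    rcases Multiset.mem_cons.1 hb with h | h
    · exact absurd h.symm hab
    · exact h
  obtain ⟨u, rfl⟩ := Multiset.exists_cons_of_mem hb'
  have h3 := cx_norm_sum_le u (fun z hz => h1 z (by simp [hz]))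
  have hna := h1 a (by simp)
  have hnb := h1 b (by simp)
  have h4 : ‖a + b‖ < 2 := by
    have : ¬ SameRay ℝ a b := by
      intro h
      exact hab (h.eq_of_norm_eq (by rw [hna, hnb]))
    have := norm_add_lt_of_not_sameRay this
    linarith
  simp only [Multiset.sum_cons, Multiset.card_cons, Nat.cast_add, Nat.cast_one]
  rw [← add_assoc]
  linarith [norm_add_le (a + b) u.sum]

/-- An algebraic integer all of whose conjugates have norm at most one, itself less than one. -/
lemma algInt_eq_zero {k : Type*} [Field k] [CharZero k] [IsAlgClosed k]
    [Algebra.IsAlgebraic ℚ k] (φ : k →+* ℂ) (α : k) (hα : IsIntegral ℤ α)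
    (hle : ∀ σ : k ≃ₐ[ℚ] k, ‖φ (σ α)‖ ≤ 1) (hlt : ‖φ α‖ < 1) :
    α = 0 := by
  have : IsAlgClosure ℚ k := ⟨inferInstance, inferInstance⟩
  have : Normal ℚ k := IsAlgClosure.normal ℚ k
  set P := minpoly ℤ α with hP
  have hmon : P.Monic := minpoly.monic hα
  have hq : minpoly ℚ α = P.map (algebraMap ℤ ℚ) := minpoly.isIntegrallyClosed_eq_field_fractions' ℚ hα
  set Q := P.map (algebraMap ℤ (k)) with hQ
  have hQm : Q.Monic := hmon.map _
  have hQs : Q.Splits := IsAlgClosed.splits _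
  have hroot : ∀ β ∈ Q.roots, ‖φ β‖ ≤ 1 := by
    intro β hβ
    have h0 : aeval β (minpoly ℚ α) = 0 := by
      have := (mem_roots'.1 hβ).2
      rw [hq, aeval_map_algebraMap]
      rwa [hQ, IsRoot.def, eval_map_algebraMap] at this
    obtain ⟨σ, hσ⟩ := minpoly.exists_algEquiv_of_root' (K := ℚ) (x := β) (y := α) (Algebra.IsAlgebraic.isAlgebraic α) h0
    rw [← hσ]; exact hle σ
  have hαr : α ∈ Q.roots := by
    rw [mem_roots hQm.ne_zero, hQ, IsRoot.def, eval_map_algebraMap]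
    exact minpoly.aeval ℤ α
  have hprod : ‖φ Q.roots.prod‖ < 1 := by
    obtain ⟨t, ht⟩ := Multiset.exists_cons_of_mem hαr
    rw [ht, Multiset.prod_cons, map_mul, norm_mul]
    have : ‖φ t.prod‖ ≤ 1 := by
      have h : ∀ β ∈ t, ‖φ β‖ ≤ 1 := fun β hβ => hroot β (by rw [ht]; simp [hβ])
      clear ht
      induction t using Multiset.induction with
      | empty => simp
      | cons a s ih =>
        rw [Multiset.prod_cons, map_mul, norm_mul]
        exact mul_le_one₀ (h a (by simp)) (norm_nonneg _) (ih (fun β hβ => h β (by simp [hβ])))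
    nlinarith [norm_nonneg (φ α), norm_nonneg (φ t.prod)]
  have hc : Q.coeff 0 = (-1) ^ Q.natDegree * Q.roots.prod := by
    exact hQs.coeff_zero_eq_prod_roots_of_monic hQm
  have hc2 : ‖φ (Q.coeff 0)‖ < 1 := by
    rw [hc]; simpa using hprod
  have hc3 : P.coeff 0 = 0 := by
    rw [hQ, coeff_map] at hc2
    simp only [algebraMap_int_eq, eq_intCast, map_intCast, Complex.norm_intCast] at hc2
    exact_mod_cast Int.abs_lt_one_iff.1 (by exact_mod_cast hc2)
  have h0 : (minpoly ℚ α).coeff 0 = 0 := by rw [hq, coeff_map, hc3, map_zero]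
  exact (minpoly.coeff_zero_eq_zero (Algebra.IsIntegral.isIntegral α)).1 h0

lemma matrix_scalar_or_trace {k : Type*} [Field k] [CharZero k] [IsAlgClosed k]
    [Algebra.IsAlgebraic ℚ k] {n : ℕ} (hn : 0 < n) (M : Matrix (Fin n) (Fin n) (k))
    (m : ℕ) (hm : 0 < m) (hM : M ^ m = 1) (hint : IsIntegral ℤ (M.trace / n)) :
    M.trace = 0 ∨ ∃ c : k, M = algebraMap _ _ c := by
  have : Nonempty (Fin n) := ⟨⟨0, hn⟩⟩
  let φ : k →+* ℂ := (IsAlgClosed.lift (R := ℚ) : k →ₐ[ℚ] ℂ).toRingHom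
  have htr : M.trace = M.charpoly.roots.sum := Matrix.trace_eq_sum_roots_charpoly M
  have hcard : Multiset.card M.charpoly.roots = n := by
    rw [← (IsAlgClosed.splits M.charpoly).natDegree_eq_card_roots, Matrix.charpoly_natDegree_eq_dim]
    simp
  have hz : aeval M (X ^ m - 1 : (k)[X]) = 0 := by simp [hM]
  have hmin : minpoly k M ∣ X ^ m - 1 := minpoly.dvd _ _ hz
  have hroots : ∀ z ∈ M.charpoly.roots, z ^ m = 1 := by
    intro z hz'
    have h1 : z ∈ spectrum k M := Matrix.mem_spectrum_of_isRoot_charpoly (mem_roots'.1 hz').2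
    have h2 := spectrum.pow_mem_pow M m h1
    rw [hM, spectrum.one_eq] at h2
    simpa using h2
  have hnorm : ∀ ψ : k →+* ℂ, ∀ z ∈ M.charpoly.roots.map ψ, ‖z‖ = 1 := by
    intro ψ z hz'
    obtain ⟨w, hw, rfl⟩ := Multiset.mem_map.1 hz'
    have : (ψ w) ^ m = 1 := by rw [← map_pow, hroots w hw, map_one]
    exact Complex.norm_eq_one_of_pow_eq_one this hm.ne'
  have hn0 : (0:ℝ) < n := by exact_mod_cast hn
  have hval : ∀ ψ : k →+* ℂ, ‖ψ (M.trace / n)‖ = ‖(M.charpoly.roots.map ψ).sum‖ / n := by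
    intro ψ
    rw [htr, map_div₀, map_natCast, norm_div, map_multiset_sum]
    simp
  by_cases hall : ∀ a ∈ M.charpoly.roots, ∀ b ∈ M.charpoly.roots, a = b
  · right
    obtain ⟨c, hc⟩ : ∃ c, c ∈ M.charpoly.roots := Multiset.card_pos_iff_exists_mem.1 (by omega)
    have hrep : M.charpoly.roots = Multiset.replicate n c := by
      rw [Multiset.eq_replicate]; exact ⟨hcard, fun b hb => hall b hb c hc⟩
    have hcp : M.charpoly = (X - C c) ^ n := by
      rw [(IsAlgClosed.splits M.charpoly).eq_prod_roots_of_monic M.charpoly_monic, hrep]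
      simp
    have hsq : Squarefree (X ^ m - 1 : (k)[X]) := by
      have := (separable_X_pow_sub_C (F := k) (n := m) 1 (by exact_mod_cast hm.ne') one_ne_zero).squarefree
      simpa using this
    have h5 : minpoly k M ∣ X - C c := by
      have h6 : minpoly k M ∣ (X - C c) ^ n := hcp ▸ Matrix.minpoly_dvd_charpoly M
      exact ((hsq.squarefree_of_dvd hmin).dvd_pow_iff_dvd hn.ne').1 h6
    have h7 : aeval M (X - C c) = 0 := by
      obtain ⟨q, hq⟩ := h5
      rw [hq, map_mul, minpoly.aeval, zero_mul]
    refine ⟨c, ?_⟩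
    simpa [sub_eq_zero] using h7
  · left
    push Not at hall
    obtain ⟨a, ha, b, hb, hab⟩ := hall
    have := algInt_eq_zero φ (M.trace / n) hint ?_ ?_
    · rw [div_eq_zero_iff] at this
      rcases this with h | h
      · exact h
      · exact absurd h (by exact_mod_cast hn.ne')
    · intro σ
      have h8 := hval (φ.comp (σ : k →+* k))
      have h9 := cx_norm_sum_le _ (hnorm (φ.comp (σ : k →+* k)))
      rw [Multiset.card_map, hcard] at h9
      have : ‖φ (σ (M.trace / n))‖ = _ := h8
      rw [this, div_le_one hn0]
      exact h9
    · rw [hval, div_lt_one hn0]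
      have := cx_norm_sum_lt _ (hnorm φ) (φ a) (φ b) (Multiset.mem_map_of_mem _ ha)
        (Multiset.mem_map_of_mem _ hb) (fun h => hab (φ.injective h))
      rwa [Multiset.card_map, hcard] at this


lemma trace_isIntegral {k : Type*} [Field k] [CharZero k] [IsAlgClosed k]
    {n : ℕ} (M : Matrix (Fin n) (Fin n) k)
    (m : ℕ) (hm : 0 < m) (hM : M ^ m = 1) : IsIntegral ℤ M.trace := by
  rcases Nat.eq_zero_or_pos n with rfl | hn
  · simp [Matrix.trace, isIntegral_zero]
  have : Nonempty (Fin n) := ⟨⟨0, hn⟩⟩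
  rw [Matrix.trace_eq_sum_roots_charpoly M]
  refine IsIntegral.multiset_sum (fun z hz' => ?_)
  have h1 : z ∈ spectrum k M := Matrix.mem_spectrum_of_isRoot_charpoly (mem_roots'.1 hz').2
  have h2 := spectrum.pow_mem_pow M m h1
  rw [hM, spectrum.one_eq] at h2
  have h3 : z ^ m = 1 := by simpa using h2
  exact IsIntegral.of_pow hm (h3 ▸ isIntegral_one)

lemma irr_dichotomy {k : Type*} [Field k] [CharZero k] [IsAlgClosed k] [Algebra.IsAlgebraic ℚ k]
    {G : Type*} [Group G] [Finite G] {n : ℕ} (hn : 0 < n) (R : G →* Matrix (Fin n) (Fin n) k)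
    (hS : ∀ M : Matrix (Fin n) (Fin n) k, (∀ h, Commute (R h) M) → ∃ c : k, M = algebraMap _ _ c)
    (g : G) (C : Finset G) (hC : ∀ h, h ∈ C ↔ IsConj g h) (p a : ℕ) (hp : p.Prime)
    (hcard : C.card = p ^ a) (hpn : ¬ p ∣ n) :
    (R g).trace = 0 ∨ ∃ c : k, R g = algebraMap _ _ c := by
  classical
  have hpow : (R g) ^ (Nat.card G) = 1 := by rw [← map_pow, pow_card_eq_one', map_one]
  have hGpos : 0 < Nat.card G := Nat.card_pos
  refine matrix_scalar_or_trace hn (R g) (Nat.card G) hGpos hpow ?_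
  have : Nonempty (Fin n) := ⟨⟨0, hn⟩⟩
  obtain ⟨ω, hω⟩ := hS (∑ c ∈ C, R c) (by
    intro h
    have : R h * (∑ c ∈ C, R c) * R h⁻¹ = ∑ c ∈ C, R c := by
      rw [Finset.mul_sum, Finset.sum_mul]
      refine Finset.sum_bij (fun c _ => h * c * h⁻¹) ?_ ?_ ?_ ?_
      · intro c hc
        rw [hC] at hc ⊢
        exact hc.trans (isConj_iff.2 ⟨h, rfl⟩)
      · intro c _ c' _ hcc
        simpa using hcc
      · intro c hc
        refine ⟨h⁻¹ * c * h, ?_, by group⟩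
        rw [hC] at hc ⊢
        exact hc.trans (isConj_iff.2 ⟨h⁻¹, by simp⟩)
      · intro c _
        simp [map_mul]
    calc R h * (∑ c ∈ C, R c) = (R h * (∑ c ∈ C, R c) * R h⁻¹) * R h := by
          rw [mul_assoc _ (R h⁻¹), ← map_mul]; simp
      _ = _ := by rw [this])
  have hωint : IsIntegral ℤ ω := by
    have h1 : IsIntegral ℤ (∑ c ∈ C, MonoidAlgebra.of ℤ G c) := by
      exact Algebra.IsIntegral.isIntegral _
    have h2 := h1.map (MonoidAlgebra.lift ℤ (Matrix (Fin n) (Fin n) k) G R)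
    rw [map_sum] at h2
    simp only [MonoidAlgebra.lift_of] at h2
    rw [hω] at h2
    exact (isIntegral_algebraMap_iff (FaithfulSMul.algebraMap_injective k (Matrix (Fin n) (Fin n) k))).1 h2
  have htr : (p ^ a : k) * (R g).trace = n * ω := by
    have h1 : (∑ c ∈ C, R c).trace = n * ω := by
      rw [hω, Matrix.algebraMap_eq_diagonal, Matrix.trace_diagonal]; simp
    rw [← h1, Matrix.trace_sum]
    rw [Finset.sum_congr rfl (g := fun _ => (R g).trace), Finset.sum_const, hcard]
    · simp
    · intro c hc
      obtain ⟨h, rfl⟩ := isConj_iff.1 ((hC c).1 hc)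
      rw [map_mul, Matrix.trace_mul_comm, ← map_mul]
      simp
  have hcop : IsCoprime ((p ^ a : ℕ) : ℤ) (n : ℤ) := by
    rw [Nat.isCoprime_iff_coprime]
    exact Nat.Coprime.pow_left _ ((Nat.Prime.coprime_iff_not_dvd hp).2 hpn)
  obtain ⟨u, v, huv⟩ := hcop
  have huv' : (u : k) * (p ^ a : k) + v * n = 1 := by exact_mod_cast congrArg (Int.cast : ℤ → k) huv
  have hn0 : (n : k) ≠ 0 := by exact_mod_cast hn.ne'
  have : (R g).trace / n = u * ω + v * (R g).trace := by
    rw [div_eq_iff hn0]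
    calc (R g).trace = (u * (p ^ a : k) + v * n) * (R g).trace := by rw [huv', one_mul]
      _ = u * ((p ^ a : k) * (R g).trace) + v * n * (R g).trace := by ring
      _ = _ := by rw [htr]; ring
  rw [this]
  have hu : IsIntegral ℤ (u : k) := by simpa using (isIntegral_algebraMap (R := ℤ) (A := k) (x := u))
  have hv : IsIntegral ℤ (v : k) := by simpa using (isIntegral_algebraMap (R := ℤ) (A := k) (x := v))
  exact (hu.mul hωint).add (hv.mul (trace_isIntegral _ _ hGpos hpow))

lemma trace_mulLeft_pi {k : Type*} [Field k] {N : ℕ} (d : Fin N → ℕ)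
    (m : Π i, Matrix (Fin (d i)) (Fin (d i)) k) :
    LinearMap.trace k _ (LinearMap.mulLeft k m) = ∑ i, (d i : k) * (m i).trace := by
  classical
  rw [LinearMap.trace_eq_matrix_trace k (Pi.basis (fun i => Matrix.stdBasis k (Fin (d i)) (Fin (d i)))),
    Matrix.trace, Fintype.sum_sigma]
  refine Finset.sum_congr rfl (fun i _ => ?_)
  rw [Fintype.sum_prod_type, Matrix.trace, Finset.mul_sum]
  refine Finset.sum_congr rfl (fun r _ => ?_)
  rw [Finset.sum_congr rfl (g := fun _ => m i r r)]
  · simp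
  · intro s _
    rw [Matrix.diag_apply, LinearMap.toMatrix_apply, Pi.basis_repr, Pi.basis_apply]
    simp only [LinearMap.mulLeft_apply, Pi.mul_apply, Pi.single_eq_same]
    rw [Matrix.stdBasis_eq_single]
    simp [Matrix.stdBasis, Matrix.mul_apply, Matrix.single_apply]

lemma trace_mulLeft_group {k : Type*} [Field k] {G : Type*} [Group G] [Finite G] (g : G) (hg : g ≠ 1) :
    LinearMap.trace k _ (LinearMap.mulLeft k (MonoidAlgebra.of k G g)) = 0 := by
  classical
  have := Fintype.ofFinite G
  rw [LinearMap.trace_eq_matrix_trace k (MonoidAlgebra.basis G k), Matrix.trace]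
  refine Finset.sum_eq_zero (fun x _ => ?_)
  rw [Matrix.diag_apply, LinearMap.toMatrix_apply]
  simp [MonoidAlgebra.basis, MonoidAlgebra.single_mul_single, hg]


lemma burnside_class_aux (k : Type*) [Field k] [CharZero k] [IsAlgClosed k] [Algebra.IsAlgebraic ℚ k]
    {G : Type*} [Group G] [Finite G] [IsSimpleGroup G] (g : G) (hg : g ≠ 1)
    (C : Finset G) (hC : ∀ h, h ∈ C ↔ IsConj g h) (p a : ℕ) (hp : p.Prime)
    (hcard : C.card = p ^ a) : ∀ x y : G, x * y = y * x := by
  classical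
  have hft := Fintype.ofFinite G
  by_contra hnc
  push Not at hnc
  obtain ⟨x₀, y₀, hxy⟩ := hnc
  have hGk : NeZero (Nat.card G : k) := ⟨by exact_mod_cast Nat.card_pos.ne'⟩
  obtain ⟨N, d, hd, ⟨e⟩⟩ := IsSemisimpleRing.exists_algEquiv_pi_matrix_of_isAlgClosed k (MonoidAlgebra k G)
  let ρ : ∀ i, MonoidAlgebra k G →ₐ[k] Matrix (Fin (d i)) (Fin (d i)) k :=
    fun i => (Pi.evalAlgHom k _ i).comp e.toAlgHom
  have hρ : ∀ i z, ρ i z = e z i := fun i z => rfl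
  let R : ∀ i, G →* Matrix (Fin (d i)) (Fin (d i)) k :=
    fun i => ((ρ i : MonoidAlgebra k G →* _)).comp (MonoidAlgebra.of k G)
  have hR : ∀ i h, R i h = ρ i (MonoidAlgebra.of k G h) := fun i h => rfl
  have hsurj : ∀ i, Function.Surjective (ρ i) := by
    intro i M
    refine ⟨e.symm (Pi.single i M), ?_⟩
    simp [hρ]
  have hdpos : ∀ i, 0 < d i := fun i => Nat.pos_of_ne_zero (hd i).out
  -- Schur
  have hS : ∀ i, ∀ M : Matrix (Fin (d i)) (Fin (d i)) k, (∀ h, Commute (R i h) M) →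
      ∃ c : k, M = algebraMap _ _ c := by
    intro i M hM
    have hall : ∀ z, Commute (ρ i z) M := by
      intro z
      induction z using MonoidAlgebra.induction_on with
      | of h => exact hM h
      | add u v hu hv => rw [map_add]; exact hu.add_left hv
      | smul c u hu => rw [map_smul]; exact hu.smul_left c
    have : M ∈ Set.range (Matrix.scalar (Fin (d i))) := by
      refine Matrix.mem_range_scalar_of_commute_single (fun r s _ => ?_)
      obtain ⟨z, hz⟩ := hsurj i (Matrix.single r s 1)
      rw [← hz]; exact hall z
    obtain ⟨c, hc⟩ := this
    exact ⟨c, hc.symm⟩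
  -- scalar implies trivial
  have htriv : ∀ i, (∃ c : k, R i g = algebraMap _ _ c) → ∀ h, R i h = 1 := by
    intro i ⟨c, hc⟩
    let Z : Subgroup G :=
      { carrier := {h | ∀ y, R i h * R i y = R i y * R i h}
        mul_mem' := by
          intro u v hu hv y
          simp only [Set.mem_ofPred_eq] at hu hv ⊢
          rw [map_mul, mul_assoc, hv, ← mul_assoc, hu, mul_assoc]
        one_mem' := by intro y; simp
        inv_mem' := by
          intro u hu y
          simp only [Set.mem_ofPred_eq] at hu ⊢
          have h1 : R i u⁻¹ * R i u = 1 := by rw [← map_mul]; simp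
          have h2 : R i u * R i u⁻¹ = 1 := by rw [← map_mul]; simp
          calc R i u⁻¹ * R i y = R i u⁻¹ * (R i y * R i u) * R i u⁻¹ := by
                rw [mul_assoc, mul_assoc, h2, mul_one]
            _ = R i u⁻¹ * (R i u * R i y) * R i u⁻¹ := by rw [hu]
            _ = _ := by rw [← mul_assoc (R i u⁻¹), h1, one_mul] }
    have hZn : Z.Normal := by
      constructor
      intro u hu w y
      have hu' : ∀ y, R i u * R i y = R i y * R i u := hu
      have : R i (w * u * w⁻¹) = R i u := by
        rw [map_mul, map_mul, ← hu', mul_assoc, ← map_mul]; simp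
      rw [this]; exact hu' y
    have hZg : g ∈ Z := by
      intro y
      rw [hc]; exact Algebra.commutes c _
    have hZtop : Z = ⊤ := by
      rcases hZn.eq_bot_or_eq_top with h | h
      · rw [h, Subgroup.mem_bot] at hZg; exact absurd hZg hg
      · exact h
    have hcomm : ∀ u y, R i u * R i y = R i y * R i u := by
      intro u
      have : u ∈ Z := hZtop ▸ Subgroup.mem_top u
      exact this
    have hker : (R i).ker = ⊤ := by
      rcases (MonoidHom.normal_ker (R i)).eq_bot_or_eq_top with h | h
      · exfalso
        have : x₀ * y₀ * x₀⁻¹ * y₀⁻¹ ∈ (R i).ker := by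
          rw [MonoidHom.mem_ker, map_mul, map_mul, map_mul, hcomm x₀ y₀, mul_assoc (R i y₀), ← map_mul]
          rw [mul_inv_cancel, map_one, mul_one, ← map_mul]; simp
        rw [h, Subgroup.mem_bot] at this
        apply hxy
        have h2 := mul_inv_eq_one.1 this
        exact mul_inv_eq_iff_eq_mul.1 h2
      · exact h
    intro h
    have : h ∈ (R i).ker := hker ▸ Subgroup.mem_top h
    exact this
  -- trivial representations: value is scalar by augmentation
  have haug : ∀ i, (∀ h, R i h = 1) → ∀ z, ρ i z = algebraMap _ _ (MonoidAlgebra.lift k k G 1 z) := by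
    intro i hi z
    induction z using MonoidAlgebra.induction_on with
    | of h => rw [← hR, hi]; simp
    | add u v hu hv => rw [map_add, hu, hv, map_add, map_add]
    | smul c u hu => rw [map_smul, hu, map_smul, smul_eq_mul, map_mul, Algebra.smul_def]
  have hex : ∃ i, ∀ h, R i h = 1 := by
    by_contra hno
    push Not at hno
    let s : MonoidAlgebra k G := ∑ h, MonoidAlgebra.of k G h
    have hs : ∀ w, MonoidAlgebra.of k G w * s = s := by
      intro w
      simp only [s, Finset.mul_sum, ← map_mul]
      exact Fintype.sum_equiv (Equiv.mulLeft w) _ _ (fun h => rfl)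
    have hs' : ∀ w, s * MonoidAlgebra.of k G w = s := by
      intro w
      simp only [s, Finset.sum_mul, ← map_mul]
      exact Fintype.sum_equiv (Equiv.mulRight w) _ _ (fun h => rfl)
    have hs0 : s = 0 := by
      apply e.injective
      rw [map_zero]
      funext i
      rw [← hρ, Pi.zero_apply]
      obtain ⟨c, hc⟩ := hS i (ρ i s) (by
        intro h
        rw [hR, commute_iff_eq, ← map_mul, ← map_mul, hs, hs'])
      obtain ⟨h, hh⟩ := hno i
      have h1 : R i h * ρ i s = ρ i s := by rw [hR, ← map_mul, hs]
      rw [hc] at h1 ⊢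
      by_cases hc0 : c = 0
      · rw [hc0, map_zero]
      · exfalso
        apply hh
        have h2 : c • R i h = c • 1 := by
          rw [← Algebra.algebraMap_eq_smul_one, Algebra.smul_def, Algebra.commutes, h1]
        exact smul_right_injective _ hc0 h2
    have h3 : MonoidAlgebra.lift k k G 1 s = (Nat.card G : k) := by
      simp [s, map_sum]
    rw [hs0, map_zero] at h3
    exact hGk.out h3.symm
  obtain ⟨i₀, hi₀⟩ := hex
  have hd0 : d i₀ = 1 := by
    by_contra h
    have h2 : 1 < d i₀ := by have := hdpos i₀; omega
    obtain ⟨z, hz⟩ := hsurj i₀ (Matrix.single ⟨0, by omega⟩ ⟨1, h2⟩ 1)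
    rw [haug i₀ hi₀] at hz
    have := congrFun (congrFun hz ⟨0, by omega⟩) ⟨1, h2⟩
    rw [Matrix.algebraMap_matrix_apply] at this
    simp at this
  have huniq : ∀ i, (∀ h, R i h = 1) → i = i₀ := by
    intro i hi
    by_contra hne
    have h1 := haug i hi (e.symm (Pi.single i 1))
    have h2 := haug i₀ hi₀ (e.symm (Pi.single i 1))
    have : Nonempty (Fin (d i)) := ⟨⟨0, hdpos i⟩⟩
    have : Nonempty (Fin (d i₀)) := ⟨⟨0, hdpos i₀⟩⟩
    rw [hρ, AlgEquiv.apply_symm_apply] at h1 h2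
    rw [Pi.single_eq_of_ne (Ne.symm hne)] at h2
    rw [Pi.single_eq_same] at h1
    have h3 := (map_eq_zero_iff _ (FaithfulSMul.algebraMap_injective k (Matrix (Fin (d i₀)) (Fin (d i₀)) k))).1 h2.symm
    rw [h3, map_zero] at h1
    exact one_ne_zero h1
  -- trace
  have hsum : ∑ i, (d i : k) * (R i g).trace = 0 := by
    have h1 := trace_mulLeft_pi (k := k) d (e (MonoidAlgebra.of k G g))
    have h2 := trace_mulLeft_group (k := k) g hg
    have h3 : LinearMap.mulLeft k (e (MonoidAlgebra.of k G g)) =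
        e.toLinearEquiv.conj (LinearMap.mulLeft k (MonoidAlgebra.of k G g)) := by
      apply LinearMap.ext
      intro m
      simp [LinearEquiv.conj_apply]
    rw [h3, LinearMap.trace_conj', h2] at h1
    exact h1.symm
  have hpow : ∀ i, (R i g) ^ (Nat.card G) = 1 := fun i => by rw [← map_pow, pow_card_eq_one', map_one]
  have hterm : ∀ i, ∃ β : k, IsIntegral ℤ β ∧ (i ≠ i₀ → (d i : k) * (R i g).trace = p * β) := by
    intro i
    by_cases hi : i = i₀
    · exact ⟨0, isIntegral_zero, fun h => absurd hi h⟩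
    by_cases hpd : p ∣ d i
    · obtain ⟨q, hq⟩ := hpd
      have hqi : IsIntegral ℤ (q : k) := by
        simpa using (isIntegral_algebraMap (R := ℤ) (A := k) (x := (q : ℤ)))
      refine ⟨q * (R i g).trace, ?_, fun _ => ?_⟩
      · exact hqi.mul (trace_isIntegral _ _ Nat.card_pos (hpow i))
      · have : (d i : k) = p * q := by rw [hq]; push_cast; rfl
        rw [this]; ring
    · refine ⟨0, isIntegral_zero, fun _ => ?_⟩
      rcases irr_dichotomy (hdpos i) (R i) (hS i) g C hC p a hp hcard hpd with h | h
      · rw [h]; ring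
      · exact absurd (huniq i (htriv i h)) hi
  choose β hβ hβ' using hterm
  have hfin : (1 : k) + p * ∑ i ∈ Finset.univ.erase i₀, β i = 0 := by
    rw [← hsum, ← Finset.add_sum_erase _ _ (Finset.mem_univ i₀), hi₀ g, hd0, Finset.mul_sum]
    congr 1
    · rw [Matrix.trace_one]; simp
    · exact Finset.sum_congr rfl (fun i hi => (hβ' i (Finset.ne_of_mem_erase hi)).symm)
  have hint : IsIntegral ℤ (∑ i ∈ Finset.univ.erase i₀, β i) := IsIntegral.sum _ (fun i _ => hβ i)
  have hp0 : (p : k) ≠ 0 := by exact_mod_cast hp.ne_zero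
  have hval : ∑ i ∈ Finset.univ.erase i₀, β i = algebraMap ℚ k (-1 / p) := by
    simp only [map_div₀, map_neg, map_one, map_natCast]
    rw [eq_div_iff hp0]
    linear_combination hfin
  rw [hval] at hint
  have hint' : IsIntegral ℤ (-1 / p : ℚ) := (isIntegral_algebraMap_iff (algebraMap ℚ k).injective).1 hint
  obtain ⟨z, hz⟩ := IsIntegrallyClosed.isIntegral_iff.1 hint'
  have hpq : (p : ℚ) ≠ 0 := by exact_mod_cast hp.ne_zero
  rw [eq_div_iff hpq] at hz
  have hz' : z * p = -1 := by
    have : (z : ℚ) * p = -1 := by simpa using hz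
    exact_mod_cast this
  have : (p : ℤ) ∣ 1 := ⟨-z, by linarith⟩
  have h1 := Int.natCast_dvd_natCast.1 (by simpa using this : (p : ℤ) ∣ ((1 : ℕ) : ℤ))
  exact hp.one_lt.ne' (Nat.dvd_one.1 h1)


lemma burnside_class {G : Type*} [Group G] [Finite G] [IsSimpleGroup G] (g : G) (hg : g ≠ 1)
    (p a : ℕ) (hp : p.Prime) (hcard : (Subgroup.centralizer {g}).index = p ^ a) :
    ∀ x y : G, x * y = y * x := by
  classical
  have hft := Fintype.ofFinite G
  have halg : Algebra.IsAlgebraic ℚ (AlgebraicClosure ℚ) := by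
    have h := AlgebraicClosure.isAlgebraic ℚ
    have h2 : (DivisionRing.toRatAlgebra : Algebra ℚ (AlgebraicClosure ℚ)) = AlgebraicClosure.instAlgebra ℚ :=
      Subsingleton.elim _ _
    rw [h2]
    exact h
  refine burnside_class_aux (AlgebraicClosure ℚ) g hg (Finset.univ.filter (fun h => IsConj g h))
    (by simp) p a hp ?_
  have hidx : (Subgroup.centralizer {g}).index = (MulAction.stabilizer (ConjAct G) g).index := by
    rw [Subgroup.centralizer_eq_comap_stabilizer]
    exact Subgroup.index_comap_of_surjective _ ConjAct.toConjAct.surjective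
  rw [← hcard, hidx, MulAction.index_stabilizer, ← Set.ncard_coe_finset]
  congr 1
  ext h
  simp only [Finset.coe_filter, Finset.mem_univ, true_and, Set.mem_ofPred_eq, ConjAct.mem_orbit_conjAct]
  exact isConj_comm

lemma isSolvable_of_normal {G : Type*} [Group G] (N : Subgroup G) [N.Normal] (h1 : Group.IsSolvable N)
    (h2 : Group.IsSolvable (G ⧸ N)) : Group.IsSolvable G :=
  (Group.isSolvable_iff_subgroup_quotient N).2 ⟨h1, h2⟩

lemma burnside_pq_aux (p q : ℕ) (hp : p.Prime) (hq : q.Prime) (m : ℕ) : ∀ (G : Type u) [Group G] [Finite G],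
    Nat.card G = m → (∀ s : ℕ, s.Prime → s ∣ Nat.card G → s = p ∨ s = q) → Group.IsSolvable G := by
  induction m using Nat.strong_induction_on with
  | _ m ih =>
  intro G _ _ hm hpq
  by_cases hN : ∃ N : Subgroup G, N.Normal ∧ N ≠ ⊥ ∧ N ≠ ⊤
  · obtain ⟨N, hn, hb, ht⟩ := hN
    have hmul := N.card_mul_index
    have hi1 : N.index ≠ 1 := fun h => ht (Subgroup.index_eq_one.1 h)
    have hi0 : N.index ≠ 0 := Subgroup.index_ne_zero_of_finite
    have hc1 : Nat.card N ≠ 1 := fun h => hb (Subgroup.card_eq_one.1 h)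
    have hc0 : 0 < Nat.card N := Nat.card_pos
    refine isSolvable_of_normal N (ih (Nat.card N) ?_ N rfl ?_) (ih (Nat.card (G ⧸ N)) ?_ (G ⧸ N) rfl ?_)
    · rw [← hm, ← hmul]; apply lt_mul_of_one_lt_right hc0; omega
    · intro s hs hd; exact hpq s hs (hd.trans N.card_subgroup_dvd_card)
    · rw [← hm, ← hmul]; apply lt_mul_of_one_lt_left <;> (first | exact Nat.pos_of_ne_zero hi0 | omega)
    · intro s hs hd; exact hpq s hs (hd.trans N.card_quotient_dvd_card)
  push Not at hN
  by_cases htr : Subsingleton G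
  · infer_instance
  rw [not_subsingleton_iff_nontrivial] at htr
  have hsimple : IsSimpleGroup G := ⟨fun N hn => by
    by_cases h : N = ⊥
    · exact Or.inl h
    · exact Or.inr (hN N hn h)⟩
  have key : ∀ p q : ℕ, p.Prime → q.Prime → (∀ s : ℕ, s.Prime → s ∣ Nat.card G → s = p ∨ s = q) →
      q ∣ Nat.card G → Group.IsSolvable G := by
    intro p q hp hq hpq hqd
    have : Fact q.Prime := ⟨hq⟩
    have : Fact p.Prime := ⟨hp⟩
    let Q : Sylow q G := default
    have hQnt : Nontrivial Q := by
      rw [← Finite.one_lt_card_iff_nontrivial]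
      have := Q.dvd_card_of_dvd_card hqd
      exact lt_of_lt_of_le hq.one_lt (Nat.le_of_dvd Nat.card_pos this)
    have := Q.isPGroup'.center_nontrivial
    obtain ⟨z, hz⟩ := exists_ne (1 : Subgroup.center Q)
    have hz1 : ((z : Q) : G) ≠ 1 := fun h => hz (Subtype.ext (Subtype.ext h))
    have hle : (Q : Subgroup G) ≤ Subgroup.centralizer {((z : Q) : G)} := by
      intro x hx
      rw [Subgroup.mem_centralizer_singleton_iff]
      have := Subgroup.mem_center_iff.1 z.2 ⟨x, hx⟩
      exact congrArg Subtype.val this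
    have hdvd := Subgroup.index_dvd_of_le hle
    have hnq := Q.not_dvd_index
    have hpp : ∃ a, (Subgroup.centralizer {((z : Q) : G)}).index = p ^ a := by
      have h0 : (Subgroup.centralizer {((z : Q) : G)}).index ≠ 0 := Subgroup.index_ne_zero_of_finite
      refine ⟨_, Nat.eq_prime_pow_of_unique_prime_dvd h0 (fun {d} hd hdd => ?_)⟩
      rcases hpq d hd (hdd.trans (Subgroup.index_dvd_card _)) with h | h
      · exact h
      · exact absurd ((h ▸ hdd).trans hdvd) hnq
    obtain ⟨a, ha⟩ := hpp
    exact Group.isSolvable_of_comm (burnside_class _ hz1 p a hp ha)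
  obtain ⟨s, hs, hsd⟩ := Nat.exists_prime_and_dvd (n := Nat.card G) (Finite.one_lt_card_iff_nontrivial.2 htr).ne'
  rcases hpq s hs hsd with rfl | rfl
  · exact key q s hq hp (fun t ht htd => (hpq t ht htd).symm) hsd
  · exact key p s hp hq hpq hsd

theorem burnside_pq {G : Type*} [Group G] [Finite G] (p q : ℕ) (hp : p.Prime) (hq : q.Prime)
    (h : ∀ s : ℕ, s.Prime → s ∣ Nat.card G → s = p ∨ s = q) : Group.IsSolvable G :=
  burnside_pq_aux p q hp hq _ G rfl h


lemma exists_mul_of_coprime_index {G : Type*} [Group G] [Finite G] (H K : Subgroup G)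
    (hc : Nat.Coprime H.index K.index) (g : G) : ∃ h ∈ H, ∃ k ∈ K, g = h * k := by
  have h1 : H.index * K.index ∣ (H ⊓ K).index :=
    hc.mul_dvd_of_dvd_of_dvd (Subgroup.index_dvd_of_le inf_le_left) (Subgroup.index_dvd_of_le inf_le_right)
  have h2 : (K.relIndex H) * H.index = (H ⊓ K).index := by
    have := Subgroup.relIndex_mul_index (inf_le_left : H ⊓ K ≤ H)
    rwa [Subgroup.inf_relIndex_left] at this
  have hH0 : H.index ≠ 0 := Subgroup.index_ne_zero_of_finite
  have h3 : K.index ≤ K.relIndex H := by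
    rw [← h2, mul_comm] at h1
    refine Nat.le_of_dvd (Nat.pos_of_ne_zero ?_) (Nat.dvd_of_mul_dvd_mul_right (Nat.pos_of_ne_zero hH0) h1)
    exact Subgroup.index_ne_zero_of_finite
  have h4 : MulAction.stabilizer H ((1 : G) : G ⧸ K) = K.subgroupOf H := by
    ext x
    rw [MulAction.mem_stabilizer_iff, Subgroup.mem_subgroupOf]
    change (((x : G) * 1 : G) : G ⧸ K) = _ ↔ _
    rw [eq_comm, QuotientGroup.eq]; simp
  have h5 := MulAction.index_stabilizer H ((1 : G) : G ⧸ K)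
  rw [h4] at h5
  have h6 : MulAction.orbit H ((1 : G) : G ⧸ K) = Set.univ := by
    refine Set.eq_of_subset_of_ncard_le (Set.subset_univ _) ?_
    rw [← h5, Set.ncard_univ]
    exact h3
  have h7 : (g : G ⧸ K) ∈ MulAction.orbit H ((1 : G) : G ⧸ K) := h6 ▸ Set.mem_univ _
  obtain ⟨x, hx⟩ := h7
  have hx' : (((x : G) * 1 : G) : G ⧸ K) = (g : G ⧸ K) := hx
  rw [QuotientGroup.eq] at hx'
  exact ⟨x, x.2, _, hx', by group⟩

/-- A nontrivial finite solvable group has a nontrivial normal `p`-subgroup. -/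
lemma exists_normal_pSubgroup {H : Type*} [Group H] [Finite H] [Group.IsSolvable H] [Nontrivial H] :
    ∃ (p : ℕ) (N : Subgroup H), p.Prime ∧ N.Normal ∧ N ≠ ⊥ ∧ IsPGroup p N := by
  classical
  have hex : ∃ n, derivedSeries H n = ⊥ := (Group.isSolvable_def H).1 inferInstance
  let n := Nat.find hex
  have hn : derivedSeries H n = ⊥ := Nat.find_spec hex
  have hn0 : n ≠ 0 := by
    intro h
    rw [h, derivedSeries_zero] at hn
    exact top_ne_bot hn
  obtain ⟨m, hm⟩ := Nat.exists_eq_succ_of_ne_zero hn0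
  have hA : derivedSeries H m ≠ ⊥ := Nat.find_min hex (show m < n by omega)
  set A := derivedSeries H m with hAdef
  have hcomm : ∀ a ∈ A, ∀ b ∈ A, a * b = b * a := by
    intro a ha b hb
    have h1 : a * b * a⁻¹ * b⁻¹ ∈ derivedSeries H (m + 1) := Subgroup.commutator_mem_commutator ha hb
    rw [show m + 1 = n from hm.symm, hn, Subgroup.mem_bot] at h1
    exact mul_inv_eq_iff_eq_mul.1 (mul_inv_eq_one.1 h1)
  have hAn : A.Normal := derivedSeries_normal H m
  have hA1 : Nat.card A ≠ 1 := fun h => hA (Subgroup.card_eq_one.1 h)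
  obtain ⟨p, hp, hpd⟩ := Nat.exists_prime_and_dvd hA1
  have : Fact p.Prime := ⟨hp⟩
  obtain ⟨x, hx⟩ := exists_prime_orderOf_dvd_card' p hpd
  let N : Subgroup H :=
    { carrier := {a | a ∈ A ∧ a ^ p = 1}
      mul_mem' := by
        rintro a b ⟨ha, ha'⟩ ⟨hb, hb'⟩
        exact ⟨A.mul_mem ha hb, by
          rw [(show Commute a b from hcomm a ha b hb).mul_pow, ha', hb', one_mul]⟩
      one_mem' := ⟨A.one_mem, one_pow _⟩
      inv_mem' := by
        rintro a ⟨ha, ha'⟩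
        exact ⟨A.inv_mem ha, by rw [inv_pow, ha', inv_one]⟩ }
  refine ⟨p, N, hp, ⟨?_⟩, ?_, ?_⟩
  · rintro a ⟨ha, ha'⟩ g
    exact ⟨hAn.conj_mem a ha g, by rw [conj_pow, ha']; simp⟩
  · intro h
    have hxN : (x : H) ∈ N := ⟨x.2, by rw [← Subgroup.coe_pow, ← hx, pow_orderOf_eq_one]; rfl⟩
    rw [h, Subgroup.mem_bot] at hxN
    have : x = 1 := Subtype.ext hxN
    rw [this, orderOf_one] at hx
    exact hp.one_lt.ne hx
  · rintro ⟨a, ha, ha'⟩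
    exact ⟨1, Subtype.ext (by simpa using ha')⟩

lemma wielandt_step {G : Type*} [Group G] [Finite G] (H K : Subgroup G) (p : ℕ) (hp : p.Prime)
    (hK : Group.IsSolvable K) (hc : Nat.Coprime H.index K.index)
    (N : Subgroup G) (hNb : N ≠ ⊥) (hNp : IsPGroup p N) (hNH : ∀ h ∈ H, ∀ x ∈ N, h * x * h⁻¹ ∈ N)
    (hpK : ¬ p ∣ K.index) : ∃ M : Subgroup G, M.Normal ∧ M ≠ ⊥ ∧ Group.IsSolvable M := by
  have : Fact p.Prime := ⟨hp⟩
  obtain ⟨Q, hQ⟩ := hNp.exists_le_sylow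
  let S : Sylow p K := default
  have hSp : IsPGroup p ((S : Subgroup K).map K.subtype) := S.isPGroup'.map _
  have hSi : ¬ p ∣ ((S : Subgroup K).map K.subtype).index := by
    rw [Subgroup.index_map_subtype]
    exact hp.prime.not_dvd_mul S.not_dvd_index hpK
  let S' : Sylow p G := hSp.toSylow hSi
  obtain ⟨g, hg⟩ := MulAction.exists_smul_eq G S' Q
  -- conjugate of K
  let L : Subgroup G := K.map (MulAut.conj g).toMonoidHom
  have hL : Group.IsSolvable L := Group.isSolvable_of_surjective
    (f := (MulAut.conj g).toMonoidHom.subgroupMap K) (MonoidHom.subgroupMap_surjective _ _)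
  have hLi : L.index = K.index := by
    exact Subgroup.index_map_equiv K (MulAut.conj g)
  have hNL : N ≤ L := by
    intro x hx
    have hxQ : x ∈ (Q : Subgroup G) := hQ hx
    rw [← hg] at hxQ
    obtain ⟨y, hy, hyx⟩ := hxQ
    have hyS : y ∈ (S : Subgroup K).map K.subtype := hy
    obtain ⟨w, hw, rfl⟩ := hyS
    exact ⟨_, w.2, hyx⟩
  refine ⟨Subgroup.normalClosure N, inferInstance, ?_, ?_⟩
  · intro h
    apply hNb
    rw [eq_bot_iff, ← h]
    exact Subgroup.le_normalClosure
  · have hle : Subgroup.normalClosure (N : Set G) ≤ L := by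
      rw [Subgroup.normalClosure, Subgroup.closure_le]
      intro x hx
      obtain ⟨y, hy, hyx⟩ := Group.mem_conjugatesOfSet_iff.1 hx
      obtain ⟨u, rfl⟩ := isConj_iff.1 hyx
      obtain ⟨h, hh, l, hl, hu⟩ := exists_mul_of_coprime_index H L (hLi ▸ hc) u⁻¹
      have hu' : u = l⁻¹ * h⁻¹ := by rw [← mul_inv_rev, ← hu, inv_inv]
      have h1 := hNL (hNH h⁻¹ (H.inv_mem hh) y hy)
      have h2 := L.mul_mem (L.mul_mem (L.inv_mem hl) h1) hl
      have h3 : u * y * u⁻¹ = l⁻¹ * (h⁻¹ * y * h⁻¹⁻¹) * l := by rw [hu']; group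
      rw [h3]
      exact h2
    exact Group.isSolvable_of_isSolvable_injective (Subgroup.inclusion_injective hle)

lemma wielandt_aux (m : ℕ) : ∀ (G : Type u) [Group G] [Finite G], Nat.card G = m →
    ∀ H₁ H₂ H₃ : Subgroup G, Group.IsSolvable H₁ → Group.IsSolvable H₂ → Group.IsSolvable H₃ →
    Nat.Coprime H₁.index H₂.index → Nat.Coprime H₁.index H₃.index → Nat.Coprime H₂.index H₃.index →
    Group.IsSolvable G := by
  induction m using Nat.strong_induction_on with
  | _ m ih =>
  intro G _ _ hm H₁ H₂ H₃ s1 s2 s3 c12 c13 c23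
  by_cases hb : H₁ = ⊥
  · rw [hb, Subgroup.index_bot] at c12
    have h1 : H₂.index = 1 := Nat.Coprime.eq_one_of_dvd c12.symm (Subgroup.index_dvd_card H₂)
    rw [Subgroup.index_eq_one] at h1
    subst h1
    exact Group.isSolvable_of_surjective (f := (Subgroup.topEquiv : _ ≃* G).toMonoidHom)
      Subgroup.topEquiv.surjective
  have hnt : Nontrivial H₁ := (Subgroup.nontrivial_iff_ne_bot H₁).2 hb
  obtain ⟨p, N, hp, hNn, hNb, hNp⟩ := exists_normal_pSubgroup (H := H₁)
  have hM : ∃ M : Subgroup G, M.Normal ∧ M ≠ ⊥ ∧ Group.IsSolvable M := by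
    have hNb' : N.map H₁.subtype ≠ ⊥ := by
      rw [Ne, Subgroup.map_eq_bot_iff_of_injective _ H₁.subtype_injective]; exact hNb
    have hNH : ∀ h ∈ H₁, ∀ x ∈ N.map H₁.subtype, h * x * h⁻¹ ∈ N.map H₁.subtype := by
      rintro h hh x ⟨y, hy, rfl⟩
      exact ⟨⟨h, hh⟩ * y * ⟨h, hh⟩⁻¹, hNn.conj_mem y hy _, rfl⟩
    by_cases hp2 : p ∣ H₂.index
    · have hp3 : ¬ p ∣ H₃.index := fun h => Nat.not_coprime_of_dvd_of_dvd hp.one_lt hp2 h c23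
      exact wielandt_step H₁ H₃ p hp s3 c13 _ hNb' (hNp.map _) hNH hp3
    · exact wielandt_step H₁ H₂ p hp s2 c12 _ hNb' (hNp.map _) hNH hp2
  obtain ⟨M, hMn, hMb, hMs⟩ := hM
  refine isSolvable_of_normal M hMs ?_
  have hc1 : Nat.card M ≠ 1 := fun h => hMb (Subgroup.card_eq_one.1 h)
  have hc0 : 0 < Nat.card M := Nat.card_pos
  have hi0 : M.index ≠ 0 := Subgroup.index_ne_zero_of_finite
  have hmap : ∀ H : Subgroup G, Group.IsSolvable H → Group.IsSolvable (H.map (QuotientGroup.mk' M)) :=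
    fun H hH => Group.isSolvable_of_surjective
      (f := (QuotientGroup.mk' M).subgroupMap H) (MonoidHom.subgroupMap_surjective _ _)
  have hidx : ∀ H : Subgroup G, (H.map (QuotientGroup.mk' M)).index ∣ H.index :=
    fun H => Subgroup.index_map_dvd H (QuotientGroup.mk'_surjective M)
  refine ih (Nat.card (G ⧸ M)) ?_ (G ⧸ M) rfl (H₁.map (QuotientGroup.mk' M))
    (H₂.map (QuotientGroup.mk' M)) (H₃.map (QuotientGroup.mk' M)) (hmap _ s1) (hmap _ s2) (hmap _ s3)
    (c12.of_dvd (hidx _) (hidx _)) (c13.of_dvd (hidx _) (hidx _)) (c23.of_dvd (hidx _) (hidx _))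
  rw [← hm, ← M.card_mul_index]
  apply lt_mul_of_one_lt_left
  · exact Nat.pos_of_ne_zero hi0
  · omega


section Cocycle

variable {X : Type v} [Fintype X] {G : Type u} [Group G] (lam : G →* Equiv.Perm X) (ppi : G → X → ℤ)

/-- The subgroup of elements whose cocycle value is divisible by `n`. -/
def congSub (hmul : ∀ g h x, ppi (g * h) x = ppi g x + ppi h ((lam g)⁻¹ x)) (n : ℕ) : Subgroup G where
  carrier := {g | ∀ x, (n : ℤ) ∣ ppi g x}
  mul_mem' := by
    intro g h hg hh x
    rw [hmul]
    exact dvd_add (hg x) (hh _)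
  one_mem' := by
    intro x
    have := hmul 1 1 x
    simp only [mul_one, map_one, inv_one, Equiv.Perm.one_apply] at this
    have h0 : ppi 1 x = 0 := by linarith
    rw [h0]; exact dvd_zero _
  inv_mem' := by
    intro g hg x
    have h1 := hmul 1 1 x
    simp only [mul_one, map_one, inv_one, Equiv.Perm.one_apply] at h1
    have h0 : ppi 1 x = 0 := by linarith
    have h2 := hmul g⁻¹ g x
    rw [inv_mul_cancel, h0] at h2
    have h3 : ppi g⁻¹ x = - ppi g ((lam g⁻¹)⁻¹ x) := by linarith
    rw [h3]
    exact (dvd_neg).2 (hg _)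

variable (hmul : ∀ g h x, ppi (g * h) x = ppi g x + ppi h ((lam g)⁻¹ x))

lemma mem_congSub (n : ℕ) (g : G) : g ∈ congSub lam ppi hmul n ↔ ∀ x, (n : ℤ) ∣ ppi g x := Iff.rfl

lemma ppi_one {X : Type v} {G : Type u} [Group G] (lam : G →* Equiv.Perm X) (ppi : G → X → ℤ)
    (hmul : ∀ g h x, ppi (g * h) x = ppi g x + ppi h ((lam g)⁻¹ x)) (x : X) : ppi 1 x = 0 := by
  have := hmul 1 1 x
  simp only [mul_one, map_one, inv_one, Equiv.Perm.one_apply] at this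
  linarith

lemma congSub_index (hsurj : Function.Surjective ppi) (n : ℕ) (hn : 0 < n) :
    (congSub lam ppi hmul n).index = n ^ Fintype.card X := by
  have hne : NeZero n := ⟨hn.ne'⟩
  letI act : MulAction G (X → ZMod n) :=
    { smul := fun g f x => (ppi g x : ZMod n) + f ((lam g)⁻¹ x)
      one_smul := by
        intro f
        funext x
        change (ppi 1 x : ZMod n) + f ((lam 1)⁻¹ x) = f x
        rw [ppi_one lam ppi hmul]; simp
      mul_smul := by
        intro g h f
        funext x
        change (ppi (g * h) x : ZMod n) + f ((lam (g * h))⁻¹ x) =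
          (ppi g x : ZMod n) + ((ppi h ((lam g)⁻¹ x) : ZMod n) + f ((lam h)⁻¹ ((lam g)⁻¹ x)))
        rw [hmul, map_mul, mul_inv_rev, Equiv.Perm.mul_apply]
        push_cast
        ring }
  have hsm : ∀ (g : G) (f : X → ZMod n) x, (g • f) x = (ppi g x : ZMod n) + f ((lam g)⁻¹ x) :=
    fun _ _ _ => rfl
  have h0 : ∀ f : X → ZMod n, ∃ g : G, g • (0 : X → ZMod n) = f := by
    intro f
    obtain ⟨g, hg⟩ := hsurj (fun x => ((f x).val : ℤ))
    refine ⟨g, ?_⟩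
    funext x
    rw [hsm, hg]
    simp
  have htr : MulAction.IsPretransitive G (X → ZMod n) := by
    constructor
    intro f f'
    obtain ⟨g, rfl⟩ := h0 f
    obtain ⟨g', rfl⟩ := h0 f'
    exact ⟨g' * g⁻¹, by rw [mul_smul, inv_smul_smul]⟩
  have hst : MulAction.stabilizer G (0 : X → ZMod n) = congSub lam ppi hmul n := by
    ext g
    rw [MulAction.mem_stabilizer_iff, mem_congSub, funext_iff]
    refine forall_congr' (fun x => ?_)
    rw [hsm, ← ZMod.intCast_zmod_eq_zero_iff_dvd]
    simp
  rw [← hst, MulAction.index_stabilizer_of_transitive]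
  rw [Nat.card_fun, Nat.card_zmod, Nat.card_eq_fintype_card]

lemma congSub_le (n m : ℕ) : congSub lam ppi hmul (n * m) ≤ congSub lam ppi hmul n := by
  intro g hg x
  exact dvd_trans ⟨m, by push_cast; ring⟩ (hg x)

lemma congSub_relIndex (hsurj : Function.Surjective ppi) (n m : ℕ) (hn : 0 < n) (hm : 0 < m) :
    (congSub lam ppi hmul (n * m)).relIndex (congSub lam ppi hmul n) = m ^ Fintype.card X := by
  have h1 := Subgroup.relIndex_mul_index (congSub_le lam ppi hmul n m)
  rw [congSub_index lam ppi hmul hsurj _ hn, congSub_index lam ppi hmul hsurj _ (Nat.mul_pos hn hm),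
    mul_pow, mul_comm] at h1
  exact Nat.eq_of_mul_eq_mul_left (Nat.pow_pos hn) h1

lemma congSub_map_solvable (hsurj : Function.Surjective ppi) (N : ℕ) (hN : 0 < N)
    (hker : congSub lam ppi hmul N ≤ lam.ker) (m : ℕ) : ∀ n, n * m = N →
    Group.IsSolvable ((congSub lam ppi hmul n).map lam) := by
  induction m using Nat.strong_induction_on with
  | _ m ih =>
  intro n hnm
  have hm : 0 < m := Nat.pos_of_ne_zero (by rintro rfl; omega)
  have hn : 0 < n := Nat.pos_of_ne_zero (by rintro rfl; omega)
  by_cases h3 : ∃ p q s : ℕ, p.Prime ∧ q.Prime ∧ s.Prime ∧ p ≠ q ∧ p ≠ s ∧ q ≠ s ∧ p ∣ m ∧ q ∣ m ∧ s ∣ m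
  · obtain ⟨p, q, s, hp, hq, hs, hpq, hps, hqs, hpm, hqm, hsm⟩ := h3
    set P := (congSub lam ppi hmul n).map lam with hP
    have key : ∀ t : ℕ, t.Prime → t ∣ m →
        Group.IsSolvable (((congSub lam ppi hmul (n * t)).map lam).subgroupOf P) ∧
        (((congSub lam ppi hmul (n * t)).map lam).subgroupOf P).index ∣ t ^ Fintype.card X := by
      intro t ht htm
      obtain ⟨m', rfl⟩ := htm
      have hm' : 0 < m' := Nat.pos_of_mul_pos_left hm
      have hlt : m' < t * m' := lt_mul_of_one_lt_left hm' ht.one_lt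
      have hsol := ih m' hlt (n * t) (by rw [mul_assoc]; exact hnm)
      have hle : (congSub lam ppi hmul (n * t)).map lam ≤ P := Subgroup.map_mono (congSub_le lam ppi hmul n t)
      refine ⟨Group.isSolvable_of_isSolvable_injective (f := (Subgroup.subgroupOfEquivOfLe hle).toMonoidHom)
        (Subgroup.subgroupOfEquivOfLe hle).injective, ?_⟩
      have h1 : ((congSub lam ppi hmul (n * t)).map lam).relIndex P ∣
          (congSub lam ppi hmul (n * t)).relIndex (congSub lam ppi hmul n) := by
        rw [hP, ← Subgroup.relIndex_comap]
        exact Subgroup.relIndex_dvd_of_le_left _ (Subgroup.le_comap_map _ _)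
      rw [congSub_relIndex lam ppi hmul hsurj n t hn ht.pos] at h1
      exact h1
    have cop : ∀ t t' : ℕ, t.Prime → t'.Prime → t ≠ t' → ∀ a b, a ∣ t ^ Fintype.card X →
        b ∣ t' ^ Fintype.card X → Nat.Coprime a b := by
      intro t t' ht ht' hne a b ha hb
      exact (Nat.Coprime.pow _ _ ((Nat.coprime_primes ht ht').2 hne)).of_dvd ha hb
    exact wielandt_aux _ P rfl _ _ _ (key p hp hpm).1 (key q hq hqm).1 (key s hs hsm).1
      (cop p q hp hq hpq _ _ (key p hp hpm).2 (key q hq hqm).2)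
      (cop p s hp hs hps _ _ (key p hp hpm).2 (key s hs hsm).2)
      (cop q s hq hs hqs _ _ (key q hq hqm).2 (key s hs hsm).2)
  · have hcard : Nat.card ((congSub lam ppi hmul n).map lam) ∣ m ^ Fintype.card X := by
      rw [← Subgroup.relIndex_ker, ← congSub_relIndex lam ppi hmul hsurj n m hn hm, hnm]
      exact Subgroup.relIndex_dvd_of_le_left _ hker
    have hprime : ∀ s : ℕ, s.Prime → s ∣ Nat.card ((congSub lam ppi hmul n).map lam) → s ∣ m :=
      fun s hs hd => hs.dvd_of_dvd_pow (hd.trans hcard)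
    obtain ⟨p, q, hp, hq, hpq⟩ : ∃ p q : ℕ, p.Prime ∧ q.Prime ∧ ∀ s : ℕ, s.Prime → s ∣ m → s = p ∨ s = q := by
      by_cases hp : ∃ p : ℕ, p.Prime ∧ p ∣ m
      · obtain ⟨p, hp, hpm⟩ := hp
        by_cases hq : ∃ q : ℕ, q.Prime ∧ q ∣ m ∧ q ≠ p
        · obtain ⟨q, hq, hqm, hqp⟩ := hq
          refine ⟨p, q, hp, hq, fun s hs hsm => ?_⟩
          by_contra hcon
          push Not at hcon
          exact h3 ⟨p, q, s, hp, hq, hs, hqp.symm, hcon.1.symm, hcon.2.symm, hpm, hqm, hsm⟩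
        · push Not at hq
          exact ⟨p, p, hp, hp, fun s hs hsm => Or.inl (hq s hs hsm)⟩
      · push Not at hp
        exact ⟨2, 2, Nat.prime_two, Nat.prime_two, fun s hs hsm => absurd hsm (hp s hs)⟩
    exact burnside_pq p q hp hq (fun s hs hd => hpq s hs (hprime s hs hd))

theorem cocycle_main {X : Type v} [Fintype X] {G : Type u} [Group G] (lam : G →* Equiv.Perm X) (ppi : G → X → ℤ)
    (hmul : ∀ g h x, ppi (g * h) x = ppi g x + ppi h ((lam g)⁻¹ x)) [DecidableEq X] (hbij : Function.Bijective ppi) (ι : X → G) (hι : ∀ x, ppi (ι x) = Pi.single x 1)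
    (hfix : ∀ x, lam (ι x) x = x) :
    (∀ g : G, ∀ k : ℕ, 1 ≤ k → g ^ k = 1 → g = 1) ∧ Group.IsSolvable G ∧
    ∃ H : Subgroup G, H.Normal ∧ (∀ a ∈ H, ∀ b ∈ H, a * b = b * a) ∧ H.index ≠ 0 := by
  have hone := ppi_one lam ppi hmul
  have hadd : ∀ g ∈ lam.ker, ∀ h, ppi (g * h) = ppi g + ppi h := by
    intro g hg h
    funext x
    rw [hmul, MonoidHom.mem_ker.1 hg]; simp
  have hab : ∀ a ∈ lam.ker, ∀ b ∈ lam.ker, a * b = b * a := by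
    intro a ha b hb
    apply hbij.1
    rw [hadd a ha, hadd b hb, add_comm]
  refine ⟨?_, ?_, lam.ker, inferInstance, hab, Subgroup.index_ker lam ▸ Nat.card_pos.ne'⟩
  · intro g k hk hgk
    have hs : ∀ x, ∑ i ∈ Finset.range k, ppi (g ^ i) x =
        ∑ i ∈ Finset.range k, ppi (g ^ i) ((lam g)⁻¹ x) + ppi g x * k := by
      intro x
      have h1 : ∑ i ∈ Finset.range k, ppi (g ^ (i + 1)) x = ∑ i ∈ Finset.range k, ppi (g ^ i) x := by
        have := Finset.sum_range_succ' (fun i => ppi (g ^ i) x) k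
        rw [Finset.sum_range_succ, hgk, pow_zero] at this
        linarith
      rw [← h1]
      simp only [pow_succ', hmul, Finset.sum_add_distrib, Finset.sum_const, Finset.card_range, nsmul_eq_mul]
      ring
    obtain ⟨h, hh⟩ := hbij.2 (fun x => (∑ i ∈ Finset.range k, ppi (g ^ i) x) / (k : ℤ))
    have : g * h = h := by
      apply hbij.1
      funext x
      rw [hmul, hh]
      simp only
      rw [hs x, Int.add_mul_ediv_right _ _ (by omega), add_comm]
    exact mul_eq_right.1 this
  · have hNpos : 0 < Nat.card (Equiv.Perm X) := Nat.card_pos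
    have hpow : ∀ x (j : ℕ), ppi (ι x ^ j) = j • Pi.single x (1 : ℤ) := by
      intro x j
      have hinv : (lam (ι x))⁻¹ x = x := by rw [Equiv.Perm.inv_eq_iff_eq, hfix]
      induction j with
      | zero => funext y; simp [hone]
      | succ j ihj =>
        funext y
        rw [pow_succ', hmul, ihj, hι, succ_nsmul']
        have : (Pi.single x (1:ℤ) : X → ℤ) ((lam (ι x))⁻¹ y) = (Pi.single x (1:ℤ) : X → ℤ) y := by
          by_cases hy : y = x
          · rw [hy, hinv]
          · have : (lam (ι x))⁻¹ y ≠ x := by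
              intro h
              rw [Equiv.Perm.inv_eq_iff_eq, hfix] at h
              exact hy h
            rw [Pi.single_eq_of_ne hy, Pi.single_eq_of_ne this]
        simp only [Pi.add_apply, Pi.smul_apply, this]
    let S : AddSubgroup (X → ℤ) :=
      { carrier := {f | ∃ h ∈ lam.ker, ppi h = Nat.card (Equiv.Perm X) • f}
        add_mem' := by
          rintro f f' ⟨h, hh, e⟩ ⟨h', hh', e'⟩
          exact ⟨h * h', lam.ker.mul_mem hh hh', by rw [hadd h hh, e, e', smul_add]⟩
        zero_mem' := ⟨1, lam.ker.one_mem, by funext x; simp [hone]⟩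
        neg_mem' := by
          rintro f ⟨h, hh, e⟩
          refine ⟨h⁻¹, lam.ker.inv_mem hh, ?_⟩
          have h1 := hadd h⁻¹ (lam.ker.inv_mem hh) h
          have h2 : ppi 1 = 0 := funext hone
          rw [inv_mul_cancel, h2, e] at h1
          rw [smul_neg]
          exact eq_neg_of_add_eq_zero_left h1.symm }
    have hsing : ∀ x, Pi.single x (1:ℤ) ∈ S := by
      intro x
      refine ⟨ι x ^ Nat.card (Equiv.Perm X), ?_, hpow x _⟩
      rw [MonoidHom.mem_ker, map_pow, pow_card_eq_one']
    have hSall : ∀ f, f ∈ S := by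
      intro f
      have : f = ∑ x, f x • Pi.single x (1:ℤ) := by
        funext y
        simp [Finset.sum_apply, Pi.single_apply]
      rw [this]
      exact S.sum_mem (fun x _ => S.zsmul_mem (hsing x) _)
    have hker : congSub lam ppi hmul (Nat.card (Equiv.Perm X)) ≤ lam.ker := by
      intro g hg
      choose f hf using hg
      obtain ⟨h, hh, e⟩ := hSall f
      have : g = h := by
        apply hbij.1
        rw [e]
        funext x
        rw [hf]; simp
      rw [this]; exact hh
    have hsol := congSub_map_solvable lam ppi hmul hbij.2 _ hNpos hker _ 1 (one_mul _)
    have htop : congSub lam ppi hmul 1 = ⊤ := by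
      rw [eq_top_iff]; intro g _ x; simp
    rw [htop] at hsol
    have hsolker : Group.IsSolvable lam.ker :=
      Group.isSolvable_of_comm (fun a b => Subtype.ext (hab a a.2 b b.2))
    refine Group.isSolvable_of_ker_le_range lam.ker.subtype (lam.subgroupMap ⊤ |>.comp (Subgroup.topEquiv (G := G)).symm.toMonoidHom) ?_
    intro g hg
    rw [Subgroup.range_subtype, MonoidHom.mem_ker]
    exact congrArg Subtype.val (MonoidHom.mem_ker.1 hg)

end Cocycle


section Bij

theorem ppi_bijective {X : Type v} [Fintype X] [DecidableEq X] {G : Type u} [Group G]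
    (lam : G →* Equiv.Perm X) (ppi : G → X → ℤ)
    (hmul : ∀ g h x, ppi (g * h) x = ppi g x + ppi h ((lam g)⁻¹ x))
    (ι : X → G) (hι : ∀ x, ppi (ι x) = Pi.single x 1)
    (hfix : ∀ x, lam (ι x) x = x) (hcl : Subgroup.closure (Set.range ι) = ⊤)
    (hcomm : ∀ u v, ι u * ι ((lam (ι u))⁻¹ v) = ι v * ι ((lam (ι v))⁻¹ u)) :
    Function.Bijective ppi := by
  have hone := ppi_one lam ppi hmul
  have hfix' : ∀ x, (lam (ι x))⁻¹ x = x := fun x => by rw [Equiv.Perm.inv_eq_iff_eq, hfix]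
  let T : X → Equiv.Perm G := fun x =>
    { toFun := fun g => g * ι ((lam g)⁻¹ x)
      invFun := fun g => g * (ι ((lam g)⁻¹ x))⁻¹
      left_inv := by
        intro g
        simp only [map_mul, mul_inv_rev, Equiv.Perm.mul_apply, hfix']
        group
      right_inv := by
        intro g
        simp only [map_mul, map_inv, mul_inv_rev, inv_inv, Equiv.Perm.mul_apply, hfix]
        group }
  have hT : ∀ x g, T x g = g * ι ((lam g)⁻¹ x) := fun _ _ => rfl
  have hTppi : ∀ x g, ppi (T x g) = ppi g + Pi.single x 1 := by
    intro x g
    funext y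
    rw [hT, hmul, hι]
    simp only [Pi.add_apply, Pi.single_apply, EmbeddingLike.apply_eq_iff_eq]
  have hTc : ∀ a ∈ Set.range T, ∀ b ∈ Set.range T, a * b = b * a := by
    rintro _ ⟨x, rfl⟩ _ ⟨y, rfl⟩
    ext g
    simp only [Equiv.Perm.mul_apply, hT, map_mul, mul_inv_rev, mul_assoc]
    rw [hcomm]
  constructor
  · letI := Subgroup.closureCommGroupOfComm hTc
    let t : X → Subgroup.closure (Set.range T) := fun x => ⟨T x, Subgroup.subset_closure ⟨x, rfl⟩⟩
    let S : (X → ℤ) → G := fun f => ((∏ x, (t x) ^ (f x) : Subgroup.closure (Set.range T)) : Equiv.Perm G) 1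
    have hS0 : S 0 = 1 := by simp [S]
    have hS1 : ∀ f x, S (f + Pi.single x 1) = T x (S f) := by
      intro f x
      have : (∏ y, (t y) ^ ((f + Pi.single x 1 : X → ℤ) y)) = t x * ∏ y, (t y) ^ (f y) := by
        simp only [Pi.add_apply, zpow_add, Finset.prod_mul_distrib, Pi.single_apply]
        rw [mul_comm]
        congr 1
        rw [Finset.prod_eq_single x] <;> simp +contextual
      simp only [S, this]
      rfl
    have key : ∀ h : G, ∀ g, S (ppi g) = g ↔ S (ppi (g * h)) = g * h := by
      intro h
      have hh : h ∈ Subgroup.closure (Set.range ι) := by rw [hcl]; trivial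
      induction hh using Subgroup.closure_induction with
      | mem h hh =>
        obtain ⟨y, rfl⟩ := hh
        intro g
        have h1 : T (lam g y) g = g * ι y := by rw [hT]; simp
        rw [← h1, hTppi, hS1, (T _).injective.eq_iff]
      | one => intro g; simp
      | mul a b _ _ ha hb => intro g; rw [ha g, hb (g * a), mul_assoc]
      | inv a _ ha => intro g; rw [ha (g * a⁻¹)]; simp
    have hSp : ∀ g, S (ppi g) = g := by
      intro g
      have := (key g 1).1 (by rw [show ppi 1 = 0 from funext hone, hS0])
      simpa using this
    exact Function.LeftInverse.injective hSp
  · let A : AddSubgroup (X → ℤ) :=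
      { carrier := {f' | ∀ f, f ∈ Set.range ppi ↔ f + f' ∈ Set.range ppi}
        add_mem' := by
          intro a b ha hb f
          rw [ha f, hb (f + a), add_assoc]
        zero_mem' := by intro f; simp
        neg_mem' := by
          intro a ha f
          rw [ha (f + -a)]; simp }
    have hsing : ∀ x, Pi.single x (1:ℤ) ∈ A := by
      intro x f
      constructor
      · rintro ⟨g, rfl⟩
        exact ⟨T x g, hTppi x g⟩
      · rintro ⟨g, hg⟩
        refine ⟨(T x).symm g, ?_⟩
        have := hTppi x ((T x).symm g)
        rw [Equiv.apply_symm_apply, hg] at this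
        exact (add_right_cancel this).symm
    intro f
    have hf : f ∈ A := by
      have : f = ∑ x, f x • Pi.single x (1:ℤ) := by
        funext y
        simp [Finset.sum_apply, Pi.single_apply]
      rw [this]
      exact A.sum_mem (fun x _ => A.zsmul_mem (hsing x) _)
    have := (hf 0).1 ⟨1, funext hone⟩
    rwa [zero_add] at this

end Bij


end Aux

/-- For a finite square-free solution `(X,r)`, the group
`G = G(X,r)` is finitely generated, torsion-free, solvable, and
abelian-by-finite (it contains an abelian normal subgroup of finite index). -/
theorem G_structure {X : Type*} [Fintype X] (r : X × X → X × X)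
    (hnd : Nondegenerate r) (hinv : Function.Involutive r) (hbr : IsBraided r)
    (hsf : ∀ x : X, r (x, x) = (x, x)) :
    Group.FG (YBGroup r) ∧
    (∀ g : YBGroup r, ∀ k : ℕ, 1 ≤ k → g ^ k = 1 → g = 1) ∧
    IsSolvable (YBGroup r) ∧
    ∃ H : Subgroup (YBGroup r), H.Normal ∧
      (∀ a ∈ H, ∀ b ∈ H, a * b = b * a) ∧ H.index ≠ 0 := by
  classical
  have hcl : Subgroup.closure (Set.range (ybι r)) = ⊤ := PresentedGroup.closure_range_of _
  refine ⟨⟨⟨(Set.finite_range (ybι r)).toFinset, by simpa using hcl⟩⟩, ?_⟩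
  let s : X → Equiv.Perm X := fun x => Equiv.ofBijective (sig r x) (hnd.1 x)
  have hs : ∀ x y, s x y = sig r x y := fun _ _ => rfl
  have hss : ∀ x y, s x * s y = s (sig r x y) * s (tau r y x) := by
    intro x y
    ext z
    have := congrArg Prod.fst (congrFun hbr (x, y, z))
    exact this.symm
  have hfix : ∀ x, s x x = x := fun x => congrArg Prod.fst (hsf x)
  have hinv1 : ∀ x y, s (sig r x y) (tau r y x) = x := fun x y => congrArg Prod.fst (hinv (x, y))
  let lam : YBGroup r →* Equiv.Perm X := PresentedGroup.toGroup (f := s) (by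
    rintro _ ⟨x, y, rfl⟩
    simp only [map_mul, map_inv, FreeGroup.lift_apply_of]
    rw [hss, mul_inv_cancel])
  have hlam : ∀ x, lam (ybι r x) = s x := fun x => PresentedGroup.toGroup.of _
  let A : X → Equiv.Perm (X → ℤ) := fun x =>
    { toFun := fun f y => (Pi.single x 1 : X → ℤ) y + f ((s x)⁻¹ y)
      invFun := fun f y => f (s x y) - (Pi.single x 1 : X → ℤ) (s x y)
      left_inv := by intro f; funext y; simp
      right_inv := by intro f; funext y; simp }
  have hA : ∀ x f y, A x f y = (Pi.single x 1 : X → ℤ) y + f ((s x)⁻¹ y) := fun _ _ _ => rfl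
  have hsing : ∀ (p : Equiv.Perm X) (x y : X), (Pi.single x 1 : X → ℤ) (p⁻¹ y) = (Pi.single (p x) 1 : X → ℤ) y := by
    intro p x y
    simp only [Pi.single_apply, Equiv.Perm.inv_eq_iff_eq]
  have hAA : ∀ x y, A x * A y = A (sig r x y) * A (tau r y x) := by
    intro x y
    ext f z
    have h1 : (s y)⁻¹ ((s x)⁻¹ z) = (s (tau r y x))⁻¹ ((s (sig r x y))⁻¹ z) := by
      rw [← Equiv.Perm.mul_apply, ← Equiv.Perm.mul_apply, ← mul_inv_rev, ← mul_inv_rev, hss]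
    simp only [Equiv.Perm.mul_apply, hA, hsing, hinv1, h1, hs x y]
    ring
  let Φ : YBGroup r →* Equiv.Perm (X → ℤ) := PresentedGroup.toGroup (f := A) (by
    rintro _ ⟨x, y, rfl⟩
    simp only [map_mul, map_inv, FreeGroup.lift_apply_of]
    rw [hAA, mul_inv_cancel])
  have hΦ : ∀ x, Φ (ybι r x) = A x := fun x => PresentedGroup.toGroup.of _
  have haff : ∀ g : YBGroup r, ∀ f x, Φ g f x = Φ g 0 x + f ((lam g)⁻¹ x) := by
    intro g
    have hg : g ∈ Subgroup.closure (Set.range (ybι r)) := by rw [hcl]; trivial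
    induction hg using Subgroup.closure_induction with
    | mem g hg =>
      obtain ⟨x, rfl⟩ := hg
      intro f y
      rw [hΦ, hA, hA, hlam]; simp
    | one => intro f x; simp
    | mul a b _ _ ha hb =>
      intro f x
      rw [map_mul, map_mul, Equiv.Perm.mul_apply, Equiv.Perm.mul_apply, ha, ha (Φ b 0), hb,
        mul_inv_rev, Equiv.Perm.mul_apply]
      ring
    | inv a _ ha =>
      intro f x
      have h1 := ha (Φ a⁻¹ f) (lam a x)
      have h2 := ha (Φ a⁻¹ 0) (lam a x)
      have h3 : ∀ f, Φ a (Φ a⁻¹ f) = f := by intro f; rw [map_inv]; simp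
      rw [h3] at h1 h2
      have h4 : (lam a)⁻¹ (lam a x) = x := by simp
      rw [h4] at h1 h2
      simp only [map_inv, inv_inv] at h1 h2 ⊢
      simp only [Pi.zero_apply] at h2
      linarith
  have hmul : ∀ (g h : YBGroup r) x, Φ (g * h) 0 x = Φ g 0 x + Φ h 0 ((lam g)⁻¹ x) := by
    intro g h x
    rw [map_mul, Equiv.Perm.mul_apply, haff]
  have hι : ∀ x, Φ (ybι r x) 0 = Pi.single x 1 := by
    intro x
    funext y
    rw [hΦ, hA]; simp
  have hfix' : ∀ x, lam (ybι r x) x = x := fun x => by rw [hlam, hfix]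
  have hrel : ∀ x y, ybι r x * ybι r y = ybι r (sig r x y) * ybι r (tau r y x) := by
    intro x y
    have : PresentedGroup.mk (ybRels r) (FreeGroup.of x * FreeGroup.of y *
      (FreeGroup.of (sig r x y) * FreeGroup.of (tau r y x))⁻¹) = 1 :=
      PresentedGroup.one_of_mem ⟨x, y, rfl⟩
    rw [map_mul, map_inv, mul_inv_eq_one, map_mul, map_mul] at this
    exact this
  have hcomm : ∀ u v, ybι r u * ybι r ((lam (ybι r u))⁻¹ v) = ybι r v * ybι r ((lam (ybι r v))⁻¹ u) := by
    intro u v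
    rw [hlam, hlam, hrel]
    have h1 : sig r u ((s u)⁻¹ v) = v := by rw [← hs]; simp
    have h2 := hinv1 u ((s u)⁻¹ v)
    rw [h1] at h2
    have h3 : (s v)⁻¹ u = tau r ((s u)⁻¹ v) u := by rw [Equiv.Perm.inv_eq_iff_eq, h2]
    rw [h1, h3]
  exact cocycle_main lam (fun g => Φ g 0) hmul
    (ppi_bijective lam (fun g => Φ g 0) hmul (ybι r) hι hfix' hcl hcomm) (ybι r) hι hfix'
end
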